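/- arXiv:2506.14002 — 8 statements merged into one kernel-verified Lean document; each statement's English description precedes it below -/
import Mathlib

section
/- Sparse activation concentration, uniform version. Fix a constant c > 0. There exists a constant C > 0, depending only on c, with the following property. Let n ≥ 2, L ≥ 1, s ≥ 1 be integers and ρ ∈ [1/n, 1]. Let G be an L×n matrix with nonnegative entries whose rows g_1,…,g_L satisfy ‖g_l‖₂ = 1 and ‖g_l‖₀ ≤ s, and whose columns satisfy ‖G_{:,i}‖₀ ≤ ρL for every i ∈ [n]. Let t be an integer with 1 ≤ t ≤ n^c, let ϑ ∈ ℝ^{t+1} and ς ∈ ℝ_{≥0}^L be fixed vectors, and let z_{−1}, z_0, …, z_{t−1} be i.i.d. standard Gaussian vectors in ℝ^n. Then for every δ ∈ (exp(−n/4), 1), with probability at least 1 − δ over the Gaussian vectors, the following holds simultaneously for every vector α = (α_{−1},…,α_{t−1}) on the unit sphere of ℝ^{t+1} and every b ∈ ℝ: writing y = Σ_{τ=−1}^{t−1} α_τ z_τ and b_l = b − ς_l·(α^⊤ϑ) for each l ∈ [L], one has (1/L) Σ_{l=1}^L 1{g_l^⊤ y > b_l} ≤ C·( (1/L) Σ_{l=1}^L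 Φ(b_l) + ρ s t log(n(1+‖ς‖_∞ ‖ϑ‖_∞)) + ρ s log(1/δ) ). -/
open MeasureTheory ProbabilityTheory

/-- The standard Gaussian tail function `Φ(x) = ∫_x^∞ (2π)^{-1/2} e^{-u²/2} du`. -/
noncomputable def gaussTail (x : ℝ) : ℝ :=
  ∫ u in Set.Ioi x, Real.exp (-(u ^ 2) / 2) / Real.sqrt (2 * Real.pi)


lemma sa_isGaussian_pi {ι : Type*} [Fintype ι] {E : ι → Type*} [∀ i, NormedAddCommGroup (E i)]
    [∀ i, NormedSpace ℝ (E i)] [∀ i, MeasurableSpace (E i)] [∀ i, BorelSpace (E i)]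
    [∀ i, SecondCountableTopology (E i)] [∀ i, CompleteSpace (E i)]
    (μ : ∀ i, Measure (E i)) [∀ i, IsGaussian (μ i)] : IsGaussian (Measure.pi μ) := by
  have h1 : iIndepFun (fun i (ω : ∀ i, E i) ↦ ω i) (Measure.pi μ) :=
    iIndepFun_pi (X := fun i (x : E i) => x) (fun i => aemeasurable_id)
  have h2 : ∀ i, HasGaussianLaw (fun ω : ∀ i, E i => ω i) (Measure.pi μ) := fun i => by
    constructor
    have := (measurePreserving_eval μ i).map_eq
    change IsGaussian ((Measure.pi μ).map (Function.eval i))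
    rw [this]; infer_instance
  have := (h1.hasGaussianLaw h2).isGaussian_map
  simpa using! this

noncomputable abbrev saG (T n : ℕ) : Measure (Fin T → Fin n → ℝ) :=
  Measure.pi fun _ : Fin T => (Measure.pi fun _ : Fin n => gaussianReal 0 1)

instance sa_gauss (T n : ℕ) : IsGaussian (saG T n) := by
  have : IsGaussian (Measure.pi fun _ : Fin n => gaussianReal 0 1) := sa_isGaussian_pi _
  exact sa_isGaussian_pi _

lemma sa_mp (T n : ℕ) (τ : Fin T) (i : Fin n) :
    MeasurePreserving (fun z : Fin T → Fin n → ℝ => z τ i) (saG T n) (gaussianReal 0 1) :=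
  (measurePreserving_eval (fun _ : Fin n => gaussianReal 0 1) i).comp
    (measurePreserving_eval (fun _ : Fin T => (Measure.pi fun _ : Fin n => gaussianReal 0 1)) τ)

lemma sa_memLp (T n : ℕ) (τ : Fin T) (i : Fin n) :
    MemLp (fun z : Fin T → Fin n → ℝ => z τ i) 2 (saG T n) :=
  (memLp_id_gaussianReal 2 : MemLp id 2 (gaussianReal 0 1)).comp_measurePreserving (sa_mp T n τ i)

lemma sa_mean (T n : ℕ) (τ : Fin T) (i : Fin n) :
    ∫ z, z τ i ∂(saG T n) = 0 := by
  have h := (sa_mp T n τ i)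
  have h2 := integral_map (μ := saG T n) h.measurable.aemeasurable
    (f := fun x : ℝ => x) (by fun_prop)
  rw [h.map_eq] at h2
  rw [← h2]; simp

lemma sa_cov (T n : ℕ) (τ τ' : Fin T) (i i' : Fin n) :
    cov[fun z : Fin T → Fin n → ℝ => z τ i, fun z => z τ' i'; saG T n]
      = if τ = τ' ∧ i = i' then 1 else 0 := by
  split_ifs with h
  · obtain ⟨rfl, rfl⟩ := h
    rw [covariance_self (sa_mp T n τ i).measurable.aemeasurable]
    have h := (sa_mp T n τ i)
    have h2 := variance_map (μ := saG T n) (X := fun x : ℝ => x) (Y := fun z => z τ i) (by fun_prop) (sa_mp T n τ i).measurable.aemeasurable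
    rw [h.map_eq] at h2
    have h3 : Var[fun x : ℝ => x; gaussianReal 0 1] = 1 := by simp
    rw [h3] at h2
    exact h2.symm
  · by_cases ht : τ = τ'
    · subst ht
      have hi : i ≠ i' := fun e => h ⟨rfl, e⟩
      have h1 : iIndepFun (fun i (ω : Fin n → ℝ) ↦ ω i) (Measure.pi fun _ : Fin n => gaussianReal 0 1) :=
        iIndepFun_pi (X := fun i (x : ℝ) => x) (fun i => aemeasurable_id)
      have h2 := h1.indepFun hi
      have hm := (measurePreserving_eval (fun _ : Fin T => (Measure.pi fun _ : Fin n => gaussianReal 0 1)) τ)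
      have h3 : IndepFun (fun z : Fin T → Fin n → ℝ => z τ i) (fun z => z τ i') (saG T n) := by
        have h4 := h2
        rw [← hm.map_eq] at h4
        have m1 := measurable_pi_apply (X := fun _ : Fin n => ℝ) i
        have m2 := measurable_pi_apply (X := fun _ : Fin n => ℝ) i'
        have m3 := hm.measurable
        rw [indepFun_iff_map_prod_eq_prod_map_map m1.aemeasurable m2.aemeasurable] at h4
        refine (indepFun_iff_map_prod_eq_prod_map_map (m1.comp m3).aemeasurable
          (m2.comp m3).aemeasurable).2 ?_
        rw [Measure.map_map (m1.prodMk m2) m3, Measure.map_map m1 m3, Measure.map_map m2 m3] at h4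
        exact h4
      exact h3.covariance_eq_zero (sa_memLp ..) (sa_memLp ..)
    · have h1 : iIndepFun (fun i (ω : Fin T → Fin n → ℝ) ↦ ω i) (saG T n) :=
        iIndepFun_pi (X := fun i (x : Fin n → ℝ) => x) (fun i => aemeasurable_id)
      have h2 := (h1.indepFun ht).comp (φ := fun x : Fin n → ℝ => x i) (ψ := fun x : Fin n → ℝ => x i')
        (measurable_pi_apply (X := fun _ : Fin n => ℝ) i) (measurable_pi_apply (X := fun _ : Fin n => ℝ) i')
      exact IndepFun.covariance_eq_zero h2 (sa_memLp ..) (sa_memLp ..)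

/-- the linear statistic -/
noncomputable def saX {T n : ℕ} (g : Fin n → ℝ) (α : Fin T → ℝ) (z : Fin T → Fin n → ℝ) : ℝ :=
  ∑ i, g i * ∑ τ, α τ * z τ i

lemma saX_eq {T n : ℕ} (g : Fin n → ℝ) (α : Fin T → ℝ) :
    saX g α = fun z => ∑ p : Fin n × Fin T, (g p.1 * α p.2) * z p.2 p.1 := by
  funext z
  simp only [saX, Fintype.sum_prod_type, Finset.mul_sum]
  simp only [mul_assoc]

@[fun_prop]
lemma saX_meas {T n : ℕ} (g : Fin n → ℝ) (α : Fin T → ℝ) : Measurable (saX g α) := by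
  unfold saX; fun_prop

lemma saX_cov {T n : ℕ} (g g' : Fin n → ℝ) (α : Fin T → ℝ) :
    cov[saX g α, saX g' α; saG T n] = (∑ i, g i * g' i) * ∑ τ, α τ ^ 2 := by
  rw [saX_eq, saX_eq, covariance_fun_sum_fun_sum]
  · simp_rw [covariance_const_mul_left, covariance_const_mul_right, sa_cov]
    have : ∀ p : Fin n × Fin T, ∑ q : Fin n × Fin T, g p.1 * α p.2 * (g' q.1 * α q.2 *
        if p.2 = q.2 ∧ p.1 = q.1 then (1:ℝ) else 0) = (g p.1 * g' p.1) * α p.2 ^ 2 := by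
      intro p
      rw [Finset.sum_eq_single p]
      · simp; ring
      · intro q _ hq
        rw [if_neg]
        · simp
        · rintro ⟨h1, h2⟩
          exact hq (Prod.ext h2.symm h1.symm)
      · simp
    simp_rw [this, Fintype.sum_prod_type, Finset.sum_mul, Finset.mul_sum]
  · intro p; exact (sa_memLp ..).const_mul _
  · intro p; exact (sa_memLp ..).const_mul _

lemma saX_mean {T n : ℕ} (g : Fin n → ℝ) (α : Fin T → ℝ) :
    ∫ z, saX g α z ∂(saG T n) = 0 := by
  rw [saX_eq, integral_finsetSum]
  · simp_rw [integral_const_mul, sa_mean]; simp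
  · intro p _; exact ((sa_memLp ..).integrable (by norm_num)).const_mul _

lemma saX_joint {T n : ℕ} {ι : Type*} [Fintype ι] (g : ι → Fin n → ℝ) (α : Fin T → ℝ) :
    HasGaussianLaw (fun z l => saX (g l) α z) (saG T n) := by
  let A : (Fin T → Fin n → ℝ) →ₗ[ℝ] (ι → ℝ) :=
    { toFun := fun z l => saX (g l) α z
      map_add' := by
        intro x y; funext l
        simp [saX, mul_add, Finset.sum_add_distrib]
      map_smul' := by
        intro c y; funext l
        simp only [saX, Pi.smul_apply, smul_eq_mul, RingHom.id_apply, Finset.mul_sum]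
        refine Finset.sum_congr rfl fun i _ => Finset.sum_congr rfl fun τ _ => ?_
        ring }
  have h := (IsGaussian.hasGaussianLaw_id (μ := saG T n)).map (LinearMap.toContinuousLinearMap A)
  exact h

lemma saX_law {T n : ℕ} (g : Fin n → ℝ) (α : Fin T → ℝ) (hg : ∑ i, g i ^ 2 = 1)
    (hα : ∑ τ, α τ ^ 2 = 1) : (saG T n).map (saX g α) = gaussianReal 0 1 := by
  have h := (saX_joint (fun _ : Unit => g) α).eval ()
  have h2 := h.map_eq_gaussianReal
  have h3 : Var[saX g α; saG T n] = 1 := by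
    rw [← covariance_self (by fun_prop), saX_cov]
    simp [← sq, hg, hα]
  change (saG T n).map (saX g α) = gaussianReal (∫ z, saX g α z ∂(saG T n)) (Var[saX g α; saG T n]).toNNReal at h2
  rw [h2, saX_mean, h3]; simp

lemma saX_indep {T n : ℕ} {ι : Type*} [Fintype ι] (g : ι → Fin n → ℝ) (α : Fin T → ℝ)
    (h : ∀ l l', l ≠ l' → ∀ i, g l i * g l' i = 0) :
    iIndepFun (fun l => saX (g l) α) (saG T n) := by
  refine (saX_joint g α).iIndepFun_of_covariance_eq_zero fun l l' hl => ?_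
  rw [saX_cov]
  simp [h l l' hl]


lemma sa_conc {Ω : Type*} [MeasurableSpace Ω] (μ : Measure Ω) [IsProbabilityMeasure μ]
    (L k : ℕ) (hk : 1 ≤ k) (col : Fin L → Fin k) (X : Fin L → Ω → ℝ) (hX : ∀ l, Measurable (X l))
    (β : Fin L → ℝ) (h : ∀ j, iIndepFun (fun l : {l // col l = j} => X l.1) μ) (u : ℝ) :
    μ {ω | 2 * (∑ l, μ.real {ω | β l < X l ω}) + k * u <
      ∑ l, if β l < X l ω then (1 : ℝ) else 0} ≤ ENNReal.ofReal (Real.exp (-u)) := by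
  have hk0 : (0 : ℝ) < k := by exact_mod_cast hk
  set p : Fin L → ℝ := fun l => μ.real {ω | β l < X l ω} with hp
  let φ : Fin L → ℝ → ENNReal := fun l x => ENNReal.ofReal (Real.exp (if β l < x then 1 else 0))
  have hφ : ∀ l, Measurable (φ l) := by
    intro l
    refine ENNReal.measurable_ofReal.comp (Real.measurable_exp.comp ?_)
    exact Measurable.ite measurableSet_Ioi measurable_const measurable_const
  have hA : ∀ l, MeasurableSet {ω | β l < X l ω} := fun l => measurableSet_lt measurable_const (hX l)
  have hF : ∀ l, ∫⁻ ω, φ l (X l ω) ∂μ ≤ ENNReal.ofReal (Real.exp (2 * p l)) := by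
    intro l
    have e1 : ∀ ω, φ l (X l ω) = 1 + {ω | β l < X l ω}.indicator
        (fun _ => ENNReal.ofReal (Real.exp 1 - 1)) ω := by
      intro ω
      by_cases hω : β l < X l ω
      · simp only [φ, hω, Set.indicator, Set.mem_ofPred_eq, if_true]
        rw [← ENNReal.ofReal_one, ← ENNReal.ofReal_add (by norm_num)]
        · congr 1; ring
        · have := Real.add_one_le_exp (1:ℝ); linarith
      · simp [φ, hω, Set.indicator]
    simp_rw [e1]
    rw [lintegral_add_left measurable_const, lintegral_indicator_const (hA l)]
    have : μ {ω | β l < X l ω} = ENNReal.ofReal (p l) := by simp [hp]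
    have h0 : (0:ℝ) ≤ p l := by simp [hp]
    have h1 : 0 ≤ Real.exp 1 - 1 := by have := Real.add_one_le_exp (1:ℝ); linarith
    rw [this, ← ENNReal.ofReal_mul h1]
    simp only [lintegral_const, measure_univ, mul_one]
    rw [← ENNReal.ofReal_one, ← ENNReal.ofReal_add (by norm_num) (by positivity)]
    apply ENNReal.ofReal_le_ofReal
    have := Real.add_one_le_exp (2 * p l)
    have h3 := Real.exp_one_lt_d9
    nlinarith
  let H : Fin k → Ω → ENNReal := fun j ω => ∏ l : {l // col l = j}, φ l.1 (X l.1 ω)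
  have hH : ∀ j, ∫⁻ ω, H j ω ∂μ ≤ ∏ l : {l // col l = j}, ENNReal.ofReal (Real.exp (2 * p l.1)) := by
    intro j
    have hi := (h j).comp (fun l => φ l.1) (fun l => hφ l.1)
    have := lintegral_prod_eq_prod_lintegral_of_indepFun Finset.univ _ hi
      (fun l => (hφ l.1).comp (hX l.1))
    simp only [Function.comp_apply] at this
    simp only [H]
    rw [this]
    exact Finset.prod_le_prod' fun l _ => hF l.1
  have hHm : ∀ j, Measurable (H j) := by
    intro j
    exact Finset.measurable_prod _ fun l _ => (hφ l.1).comp (hX l.1)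
  have hold := ENNReal.lintegral_prod_norm_pow_le (μ := μ) (Finset.univ : Finset (Fin k))
    (f := H) (fun j _ => (hHm j).aemeasurable) (p := fun _ => (1 / k : ℝ))
    (by simp; field_simp) (fun _ _ => by positivity)
  have e2 : ∀ ω, ∏ j, H j ω ^ (1 / k : ℝ) =
      ENNReal.ofReal (Real.exp ((∑ l, if β l < X l ω then (1 : ℝ) else 0) / k)) := by
    intro ω
    rw [ENNReal.prod_rpow_of_nonneg (by positivity)]
    simp only [H]
    rw [Fintype.prod_fiberwise col (fun l => φ l (X l ω))]
    simp only [φ]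
    rw [← ENNReal.ofReal_prod_of_nonneg (fun _ _ => (Real.exp_pos _).le), ← Real.exp_sum,
      ENNReal.ofReal_rpow_of_pos (Real.exp_pos _), ← Real.exp_mul]
    congr 2; ring
  have e3 : ∏ j, (∫⁻ ω, H j ω ∂μ) ^ (1 / k : ℝ) ≤
      ENNReal.ofReal (Real.exp ((2 * ∑ l, p l) / k)) := by
    rw [ENNReal.prod_rpow_of_nonneg (by positivity)]
    calc (∏ j, ∫⁻ ω, H j ω ∂μ) ^ (1 / k : ℝ)
        ≤ (∏ j, ∏ l : {l // col l = j}, ENNReal.ofReal (Real.exp (2 * p l.1))) ^ (1 / k : ℝ) := by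
          apply ENNReal.rpow_le_rpow _ (by positivity)
          exact Finset.prod_le_prod' fun j _ => hH j
      _ = _ := by
          rw [Fintype.prod_fiberwise col (fun l => ENNReal.ofReal (Real.exp (2 * p l)))]
          rw [← ENNReal.ofReal_prod_of_nonneg (fun _ _ => (Real.exp_pos _).le), ← Real.exp_sum,
            ENNReal.ofReal_rpow_of_pos (Real.exp_pos _), ← Real.exp_mul, ← Finset.mul_sum]
          congr 2; ring
  simp_rw [e2] at hold
  have hold2 := hold.trans e3
  set f : Ω → ℝ := fun ω => ∑ l, if β l < X l ω then (1 : ℝ) else 0 with hf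
  have hfm : Measurable f :=
    Finset.measurable_sum _ fun l _ => Measurable.ite (hA l) measurable_const measurable_const
  have mk := mul_meas_ge_le_lintegral₀ (μ := μ)
    (f := fun ω => ENNReal.ofReal (Real.exp (f ω / k)))
    (by fun_prop) (ENNReal.ofReal (Real.exp (2 * (∑ l, p l) / k + u)))
  have mk2 := mk.trans hold2
  have hsub : {ω | 2 * (∑ l, p l) + k * u < f ω} ⊆ {x | ENNReal.ofReal (Real.exp (2 * (∑ l, p l) / k + u)) ≤
      ENNReal.ofReal (Real.exp (f x / k))} := by
    intro ω hω
    simp only [Set.mem_ofPred_eq] at hω ⊢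
    apply ENNReal.ofReal_le_ofReal
    apply Real.exp_le_exp.2
    rw [le_div_iff₀ hk0, add_mul, div_mul_cancel₀ _ hk0.ne']
    linarith
  refine (measure_mono hsub).trans ?_
  rw [Real.exp_add, ENNReal.ofReal_mul (Real.exp_pos _).le, mul_assoc] at mk2
  have h5 : ENNReal.ofReal (Real.exp u) * μ {x | ENNReal.ofReal (Real.exp (2 * (∑ l, p l) / k + u)) ≤
      ENNReal.ofReal (Real.exp (f x / k))} ≤ 1 := by
    have h6 : ENNReal.ofReal (Real.exp (2 * (∑ l, p l) / k)) ≠ 0 := by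
      simp [Real.exp_pos]
    rw [← ENNReal.mul_le_mul_iff_right h6 ENNReal.ofReal_ne_top, mul_one, Real.exp_add, ENNReal.ofReal_mul (Real.exp_pos _).le]
    exact mk2
  rw [Real.exp_neg, ENNReal.ofReal_inv_of_pos (Real.exp_pos _)]
  rw [← ENNReal.div_eq_inv_mul.trans (mul_one _)] 
  rw [ENNReal.le_div_iff_mul_le (by simp [Real.exp_pos]) (by simp), mul_comm]
  exact h5

lemma sa_color {ι : Type*} [DecidableEq ι] (R : ι → ι → Prop) [DecidableRel R]
    (k : ℕ) (S U : Finset ι) (hSU : S ⊆ U) (hsymm : ∀ a b, R a b → R b a) (hrefl : ∀ a, R a a)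
    (hdeg : ∀ a, (U.filter (R a)).card ≤ k) (hk : 1 ≤ k):
    ∃ col : ι → Fin k, ∀ a ∈ S, ∀ b ∈ S, a ≠ b → R a b → col a ≠ col b := by
  induction S using Finset.induction_on with
  | empty => exact ⟨fun _ => ⟨0, hk⟩, by simp⟩
  | insert a S ha ih =>
    obtain ⟨col, hcol⟩ := ih ((Finset.subset_insert _ _).trans hSU)
    have haU : a ∈ U := hSU (Finset.mem_insert_self _ _)
    have : ∃ x : Fin k, x ∉ ((S.filter (R a)).image col) := by
      by_contra! hcon
      have h1 : (Finset.univ : Finset (Fin k)) ⊆ (S.filter (R a)).image col := fun x _ => hcon x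
      have h2 := Finset.card_le_card h1
      have h3 := Finset.card_image_le (s := S.filter (R a)) (f := col)
      have h4 : (S.filter (R a)).card < (U.filter (R a)).card := by
        apply Finset.card_lt_card
        rw [Finset.ssubset_iff_of_subset]
        · exact ⟨a, by simp [haU, hrefl], by simp [ha]⟩
        · exact Finset.filter_subset_filter _ ((Finset.subset_insert _ _).trans hSU)
      have h5 := hdeg a
      simp at h2
      omega
    obtain ⟨x, hx⟩ := this
    have hx' : ∀ b ∈ S, R a b → col b ≠ x := by
      intro b hb hab hc
      exact hx (Finset.mem_image.2 ⟨b, by simp [hb, hab], hc⟩)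
    refine ⟨Function.update col a x, ?_⟩
    intro b hb c hc hbc hR
    rcases Finset.mem_insert.1 hb with rfl | hb'
    · rcases Finset.mem_insert.1 hc with rfl | hc'
      · exact absurd rfl hbc
      · rw [Function.update_self, Function.update_of_ne hbc.symm]
        exact (hx' c hc' hR).symm
    · have hba : b ≠ a := fun e => ha (e ▸ hb')
      rcases Finset.mem_insert.1 hc with rfl | hc'
      · rw [Function.update_self, Function.update_of_ne hba]
        exact hx' b hb' (hsymm _ _ hR)
      · have hca : c ≠ a := fun e => ha (e ▸ hc')
        rw [Function.update_of_ne hba, Function.update_of_ne hca]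
        exact hcol b hb' c hc' hbc hR

lemma gt_integrable : Integrable (fun u : ℝ => Real.exp (-(u ^ 2) / 2) / Real.sqrt (2 * Real.pi)) := by
  have := integrable_gaussianPDFReal 0 1
  refine this.congr (Filter.Eventually.of_forall fun u => ?_)
  simp [gaussianPDFReal]; ring

lemma gt_eq (x : ℝ) : gaussTail x = (gaussianReal 0 1).real (Set.Ioi x) := by
  rw [Measure.real, gaussianReal_apply_eq_integral _ (by norm_num), ENNReal.toReal_ofReal
    (setIntegral_nonneg measurableSet_Ioi fun u _ => gaussianPDFReal_nonneg _ _ _)]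
  unfold gaussTail
  congr 1; funext u
  simp [gaussianPDFReal]; ring

lemma gt_nonneg (x : ℝ) : 0 ≤ gaussTail x := by rw [gt_eq]; positivity

lemma gt_anti {x y : ℝ} (h : x ≤ y) : gaussTail y ≤ gaussTail x := by
  rw [gt_eq, gt_eq]; exact measureReal_mono (Set.Ioi_subset_Ioi h)

lemma gt_half {x : ℝ} (h : x ≤ 0) : 1 / 2 ≤ gaussTail x := by
  refine le_trans (le_of_eq ?_) (gt_anti h)
  unfold gaussTail
  rw [integral_div]
  have := integral_gaussian_Ioi (1/2)
  have h2 : ∀ u : ℝ, -(u^2)/2 = -(1/2) * u^2 := fun u => by ring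
  simp_rw [h2]
  rw [this]
  have h3 : Real.pi / (1/2) = 2 * Real.pi := by ring
  rw [h3]
  have : Real.sqrt (2 * Real.pi) ≠ 0 := by positivity
  field_simp

lemma gt_shift (x h : ℝ) (hh : 0 ≤ h) : gaussTail (x - h) ≤ gaussTail x + h := by
  unfold gaussTail
  rw [← Set.Ioc_union_Ioi_eq_Ioi (show x - h ≤ x by linarith), setIntegral_union
    (Set.Ioc_disjoint_Ioi le_rfl) measurableSet_Ioi gt_integrable.integrableOn gt_integrable.integrableOn]
  have h1 : ∫ u in Set.Ioc (x-h) x, Real.exp (-(u ^ 2) / 2) / Real.sqrt (2 * Real.pi) ≤ ∫ u in Set.Ioc (x-h) x, (1:ℝ) := by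
    apply setIntegral_mono gt_integrable.integrableOn (by simp)
    intro u
    have h2 : 1 ≤ Real.sqrt (2 * Real.pi) := by
      rw [Real.one_le_sqrt]; have := Real.pi_gt_three; linarith
    have h3 : Real.exp (-(u^2)/2) ≤ 1 := Real.exp_le_one_iff.2 (by nlinarith [sq_nonneg u])
    exact div_le_one_of_le₀ (h3.trans h2) (by positivity)
  have h4 : ∫ u in Set.Ioc (x-h) x, (1:ℝ) = h := by simp [hh]
  linarith

lemma gauss_abs_tail (M : ℝ) (hM : 0 ≤ M) :
    (gaussianReal 0 1) {x | M < |x|} ≤ ENNReal.ofReal (2 * Real.exp (-M^2/2)) := by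
  have hs : HasSubgaussianMGF id 1 (gaussianReal 0 1) := by
    constructor
    · intro t; exact integrable_exp_mul_gaussianReal t
    · intro t; rw [mgf_id_gaussianReal]; simp
  have h1 := hs.measure_ge_le hM
  have h2 := hs.neg.measure_ge_le hM
  have : {x : ℝ | M < |x|} ⊆ {x | M ≤ id x} ∪ {x | M ≤ (-id) x} := by
    intro x hx
    have hx' : M < |x| := by simpa using hx
    rcases lt_abs.1 hx' with h | h
    · left; simpa using h.le
    · right; simpa using h.le
  refine (measure_mono this).trans ((measure_union_le _ _).trans ?_)
  rw [two_mul, ENNReal.ofReal_add (Real.exp_pos _).le (Real.exp_pos _).le]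
  simp only [NNReal.coe_one, mul_one] at h1 h2
  gcongr
  · rw [← ofReal_measureReal]; exact ENNReal.ofReal_le_ofReal h1
  · rw [← ofReal_measureReal]; exact ENNReal.ofReal_le_ofReal h2

lemma saX_sub {T n : ℕ} (g : Fin n → ℝ) (α α' : Fin T → ℝ) (z : Fin T → Fin n → ℝ) :
    saX g α z - saX g α' z = saX g (fun τ => α τ - α' τ) z := by
  simp only [saX, ← Finset.sum_sub_distrib, ← mul_sub, sub_mul]

lemma saX_bound {T n : ℕ} (g : Fin n → ℝ) (v : Fin T → ℝ) (z : Fin T → Fin n → ℝ) (e M : ℝ)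
    (hg : ∀ i, |g i| ≤ 1) (hv : ∀ τ, |v τ| ≤ e) (hz : ∀ τ i, |z τ i| ≤ M) (he : 0 ≤ e)
    (hM : 0 ≤ M) : |saX g v z| ≤ n * (T * (e * M)) := by
  unfold saX
  refine (Finset.abs_sum_le_sum_abs _ _).trans ?_
  have h1 : ∀ i, |∑ τ, v τ * z τ i| ≤ T * (e * M) := by
    intro i
    refine (Finset.abs_sum_le_sum_abs _ _).trans ?_
    refine (Finset.sum_le_card_nsmul _ _ (e * M) fun τ _ => ?_).trans (by simp)
    rw [abs_mul]
    exact mul_le_mul (hv τ) (hz τ i) (abs_nonneg _) he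
  refine (Finset.sum_le_card_nsmul _ _ (T * (e * M)) fun i _ => ?_).trans (by simp)
  rw [abs_mul]
  calc |g i| * |∑ τ, v τ * z τ i| ≤ 1 * (T * (e * M)) :=
        mul_le_mul (hg i) (h1 i) (abs_nonneg _) zero_le_one
    _ = _ := one_mul _

lemma sa_dot_bound {T : ℕ} (a A D e : ℝ) (v ϑ : Fin T → ℝ) (ha : |a| ≤ A) (hv : ∀ τ, |v τ| ≤ e)
    (hϑ : ∀ τ, |ϑ τ| ≤ D) (he : 0 ≤ e) : |a * ∑ τ, v τ * ϑ τ| ≤ T * e * (A * D) := by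
  rw [abs_mul]
  have h1 : |∑ τ, v τ * ϑ τ| ≤ T * (e * D) := by
    refine (Finset.abs_sum_le_sum_abs _ _).trans ?_
    refine (Finset.sum_le_card_nsmul _ _ (e * D) fun τ _ => ?_).trans (by simp)
    rw [abs_mul]
    exact mul_le_mul (hv τ) (hϑ τ) (abs_nonneg _) he
  calc |a| * |∑ τ, v τ * ϑ τ| ≤ A * (T * (e * D)) :=
        mul_le_mul ha h1 (abs_nonneg _) ((abs_nonneg _).trans ha)
    _ = _ := by ring

lemma sa_event (n L s : ℕ) (hL : 1 ≤ L) (ρ : ℝ) (G : Fin L → Fin n → ℝ)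
    (hG : ∀ l, ∑ i, G l i ^ 2 = 1)
    (hs : ∀ l, (Function.support (G l)).ncard ≤ s)
    (hcol : ∀ i : Fin n, ((Function.support fun l => G l i).ncard : ℝ) ≤ ρ * L) (hρ : 0 ≤ ρ) :
    ∃ k : ℕ, 1 ≤ k ∧ (k : ℝ) ≤ ρ * s * L ∧ ∀ (T : ℕ) (α : Fin T → ℝ), ∑ τ, α τ ^ 2 = 1 →
      ∀ (β : Fin L → ℝ) (u : ℝ), (saG T n) {z | 2 * (∑ l, gaussTail (β l)) + k * u <
        ∑ l, if β l < saX (G l) α z then (1 : ℝ) else 0} ≤ ENNReal.ofReal (Real.exp (-u)) := by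
  classical
  let R : Fin L → Fin L → Prop := fun a b => ∃ i, G a i ≠ 0 ∧ G b i ≠ 0
  have hsymm : ∀ a b, R a b → R b a := fun a b ⟨i, h1, h2⟩ => ⟨i, h2, h1⟩
  have hrefl : ∀ a, R a a := by
    intro a
    by_contra hcon
    have : ∀ i, G a i = 0 := by
      intro i; by_contra h; exact hcon ⟨i, h, h⟩
    have h2 := hG a
    simp [this] at h2
  have hdegR : ∀ a, ((Finset.univ.filter (R a)).card : ℝ) ≤ ρ * s * L := by
    intro a
    have h1 : Finset.univ.filter (R a) ⊆ (Finset.univ.filter fun i => G a i ≠ 0).biUnion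
        (fun i => Finset.univ.filter fun l => G l i ≠ 0) := by
      intro b hb
      simp only [Finset.mem_filter, Finset.mem_univ, true_and, Finset.mem_biUnion, R] at hb ⊢
      exact hb
    have h2 := (Finset.card_le_card h1).trans Finset.card_biUnion_le
    have h3 : ∀ i, ((Finset.univ.filter fun l => G l i ≠ 0).card : ℝ) ≤ ρ * L := by
      intro i
      have := hcol i
      rwa [Set.ncard_eq_toFinset_card', show (Function.support fun l => G l i).toFinset =
        Finset.univ.filter fun l => G l i ≠ 0 by ext; simp] at this
    have h4 : (Finset.univ.filter fun i => G a i ≠ 0).card ≤ s := by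
      have := hs a
      rwa [Set.ncard_eq_toFinset_card', show (Function.support (G a)).toFinset =
        Finset.univ.filter fun i => G a i ≠ 0 by ext; simp] at this
    have h5 : ((Finset.univ.filter (R a)).card : ℝ) ≤
        ∑ i ∈ Finset.univ.filter (fun i => G a i ≠ 0),
          ((Finset.univ.filter fun l => G l i ≠ 0).card : ℝ) := by exact_mod_cast h2
    refine h5.trans ((Finset.sum_le_card_nsmul _ _ (ρ * L) fun i _ => h3 i).trans ?_)
    rw [nsmul_eq_mul]
    have h6 : ((Finset.univ.filter fun i => G a i ≠ 0).card : ℝ) ≤ s := by exact_mod_cast h4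
    have h7 : 0 ≤ ρ * L := by positivity
    nlinarith
  have hnn : 0 ≤ ρ * s * L := by positivity
  have hdeg : ∀ a, (Finset.univ.filter (R a)).card ≤ ⌊ρ * s * L⌋₊ := fun a => Nat.le_floor (hdegR a)
  have hk : 1 ≤ ⌊ρ * s * L⌋₊ := by
    refine le_trans ?_ (hdeg ⟨0, hL⟩)
    exact Finset.card_pos.2 ⟨⟨0, hL⟩, by simp [hrefl]⟩
  obtain ⟨col, hc⟩ := sa_color R ⌊ρ * s * L⌋₊ Finset.univ Finset.univ (Finset.subset_univ _)
    hsymm hrefl hdeg hk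
  refine ⟨⌊ρ * s * L⌋₊, hk, Nat.floor_le hnn, ?_⟩
  intro T α hα β u
  have key := sa_conc (saG T n) L _ hk col (fun l => saX (G l) α) (fun l => saX_meas _ _) β
    (fun j => saX_indep (fun l : {l // col l = j} => G l.1) α (by
      intro l l' hl i
      by_contra hne
      have hne' : G l.1 i ≠ 0 ∧ G l'.1 i ≠ 0 := by simpa using hne
      exact hc l.1 (Finset.mem_univ _) l'.1 (Finset.mem_univ _) (fun e => hl (Subtype.ext e))
        ⟨i, hne'⟩ (l.2.trans l'.2.symm))) u
  have hp : ∀ l, (saG T n).real {z | β l < saX (G l) α z} = gaussTail (β l) := by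
    intro l
    rw [gt_eq, ← saX_law (G l) α (hG l) hα, map_measureReal_apply (saX_meas _ _) measurableSet_Ioi]
    rfl
  simp only [hp] at key
  exact key

lemma sa_max (T n : ℕ) (hT : 1 ≤ T) (hn : 1 ≤ n) (δ : ℝ) (hδ : Real.exp (-(n : ℝ) / 4) < δ) :
    (saG T n) {z | ∃ τ i, 4 * (n : ℝ) * T < |z τ i|} ≤ ENNReal.ofReal (δ / 2) := by
  have hT' : (1 : ℝ) ≤ T := by exact_mod_cast hT
  have hn' : (1 : ℝ) ≤ n := by exact_mod_cast hn
  set M : ℝ := 4 * n * T with hM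
  have hM0 : 0 ≤ M := by positivity
  have e1 : {z : Fin T → Fin n → ℝ | ∃ τ i, M < |z τ i|} =
      ⋃ p : Fin T × Fin n, {z | M < |z p.1 p.2|} := by
    ext z; simp
  rw [e1]
  refine (measure_iUnion_fintype_le _ _).trans ?_
  have h1 : ∀ p : Fin T × Fin n, (saG T n) {z | M < |z p.1 p.2|} ≤
      ENNReal.ofReal (2 * Real.exp (-M^2/2)) := by
    intro p
    have hm := sa_mp T n p.1 p.2
    have hset : MeasurableSet {x : ℝ | M < |x|} := measurableSet_lt measurable_const (by fun_prop)
    have := hm.measure_preimage hset.nullMeasurableSet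
    refine le_trans (le_of_eq ?_) (this.le.trans (gauss_abs_tail M hM0))
    rfl
  refine (Finset.sum_le_card_nsmul _ _ _ fun p _ => h1 p).trans ?_
  rw [nsmul_eq_mul, ← ENNReal.ofReal_natCast, ← ENNReal.ofReal_mul (by positivity)]
  apply ENNReal.ofReal_le_ofReal
  simp only [Finset.card_univ, Fintype.card_prod, Fintype.card_fin, Nat.cast_mul]
  have hx : 1 ≤ (n:ℝ) * T := by nlinarith
  have h2 : Real.exp (-M^2/2) ≤ Real.exp (-(4 * n * T)) * Real.exp (-(n:ℝ)/4) := by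
    rw [← Real.exp_add]
    apply Real.exp_le_exp.2
    have : (n:ℝ) ≤ n * T := by nlinarith
    have : M^2/2 = 8 * (n*T)^2 := by rw [hM]; ring
    nlinarith
  have h3 : 4 * (n:ℝ) * T * Real.exp (-(4*n*T)) ≤ 1 := by
    rw [Real.exp_neg, ← div_eq_mul_inv]
    apply div_le_one_of_le₀ _ (Real.exp_pos _).le
    have := Real.add_one_le_exp (4*(n:ℝ)*T); linarith
  have h4 : 0 ≤ Real.exp (-(n:ℝ)/4) := (Real.exp_pos _).le
  calc (T:ℝ) * n * (2 * Real.exp (-M^2/2)) ≤ (T:ℝ) * n * (2 * (Real.exp (-(4 * n * T)) * Real.exp (-(n:ℝ)/4))) := by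
        gcongr
    _ = (4 * (n:ℝ) * T * Real.exp (-(4*n*T))) * Real.exp (-(n:ℝ)/4) / 2 := by ring
    _ ≤ 1 * Real.exp (-(n:ℝ)/4) / 2 := by gcongr
    _ ≤ δ / 2 := by linarith

lemma sa_logN (c : ℝ) (hc : 0 < c) (n t m : ℕ) (hn : 2 ≤ n) (ht : 1 ≤ t)
    (htn : (t : ℝ) ≤ (n : ℝ) ^ c) (Q : ℝ) (hQ : 0 ≤ Q)
    (hm : (m : ℝ) ≤ 16 * (n:ℝ)^5 * ((t:ℝ)+1)^4 * (1+Q)^2 + 1) :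
    Real.log (((2 * m + 1 : ℕ) : ℝ) ^ (t + 2)) ≤
      3 * t * (16 + 4 * c) * Real.log ((n : ℝ) * (1 + Q)) := by
  have hn' : (2 : ℝ) ≤ n := by exact_mod_cast hn
  have ht' : (1 : ℝ) ≤ t := by exact_mod_cast ht
  have hl1 : Real.log ((n : ℝ) * (1 + Q)) = Real.log n + Real.log (1 + Q) :=
    Real.log_mul (by positivity) (by positivity)
  have hq : 0 ≤ Real.log (1+Q) := Real.log_nonneg (by linarith)
  have hl2 : Real.log 2 ≤ Real.log n := Real.log_le_log (by norm_num) hn'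
  have hl20 : 0 < Real.log 2 := Real.log_pos (by norm_num)
  set ℓ := Real.log ((n : ℝ) * (1 + Q)) with hℓ
  have hT : Real.log ((t:ℝ)+1) ≤ (1 + c) * ℓ := by
    have h1 : (t:ℝ) + 1 ≤ 2 * (n:ℝ)^c := by linarith
    have h2 := Real.log_le_log (by positivity) h1
    rw [Real.log_mul (by norm_num) (by positivity), Real.log_rpow (by positivity)] at h2
    nlinarith
  have h80 : Real.log 80 ≤ 7 * Real.log 2 := by
    rw [show 7 * Real.log 2 = Real.log (2^7) by rw [Real.log_pow]; norm_num]
    exact Real.log_le_log (by norm_num) (by norm_num)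
  have hA : 1 ≤ 16 * (n:ℝ)^5 * ((t:ℝ)+1)^4 * (1+Q)^2 := by
    have a1 : 1 ≤ (n:ℝ)^5 := one_le_pow₀ (by linarith)
    have a2 : 1 ≤ ((t:ℝ)+1)^4 := one_le_pow₀ (by linarith)
    have a3 : 1 ≤ (1+Q)^2 := one_le_pow₀ (by linarith)
    have a4 : 1 ≤ (n:ℝ)^5 * ((t:ℝ)+1)^4 := one_le_mul_of_one_le_of_one_le a1 a2
    have a5 : 1 ≤ (n:ℝ)^5 * ((t:ℝ)+1)^4 * (1+Q)^2 := one_le_mul_of_one_le_of_one_le a4 a3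
    linarith
  have hm2 : ((2 * m + 1 : ℕ) : ℝ) ≤ 80 * (n:ℝ)^5 * ((t:ℝ)+1)^4 * (1+Q)^2 := by
    push_cast; linarith
  have h3 := Real.log_le_log (by positivity) hm2
  rw [Real.log_mul (by positivity) (by positivity), Real.log_mul (by positivity) (by positivity),
    Real.log_mul (by positivity) (by positivity), Real.log_pow, Real.log_pow, Real.log_pow] at h3
  push_cast at h3
  have h4 : Real.log ((2 * m + 1 : ℕ) : ℝ) ≤ (16 + 4 * c) * ℓ := by
    push_cast
    nlinarith
  rw [Real.log_pow]
  push_cast at h4 ⊢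
  have h5 : 0 ≤ (16 + 4 * c) * ℓ := mul_nonneg (by linarith) (by linarith)
  calc ((t:ℝ) + 2) * Real.log (2 * m + 1) ≤ ((t:ℝ)+2) * ((16 + 4 * c) * ℓ) := by gcongr
    _ ≤ (3 * t) * ((16 + 4 * c) * ℓ) := by gcongr; linarith
    _ = _ := by ring

/-- final arithmetic -/
lemma sa_arith (c : ℝ) (hc : 0 < c) (n L s t : ℕ) (hn : 2 ≤ n) (hL : 1 ≤ L) (hs : 1 ≤ s) (ht : 1 ≤ t)
    (ρ : ℝ) (hρ : (n : ℝ)⁻¹ ≤ ρ) (ℓ d logN u k f p pβ : ℝ) (hℓ : Real.log 2 ≤ ℓ) (hd : 0 ≤ d)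
    (hk : k ≤ ρ * s * L) (hN0 : 0 ≤ logN) (hN : logN ≤ 3 * t * (16 + 4 * c) * ℓ)
    (hu : u = Real.log 2 + logN + d) (hp : 0 ≤ p) (hpβ : pβ ≤ p + L * (4 / n))
    (hf : f ≤ 2 * pβ + k * u) :
    (1 / (L:ℝ)) * f ≤ (100 + 12 * c) * ((1 / (L:ℝ)) * p + ρ * s * t * ℓ + ρ * s * d) := by
  have hn' : (2 : ℝ) ≤ n := by exact_mod_cast hn
  have ht' : (1 : ℝ) ≤ t := by exact_mod_cast ht
  have hs' : (1 : ℝ) ≤ s := by exact_mod_cast hs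
  have hL' : (1 : ℝ) ≤ L := by exact_mod_cast hL
  have hl := Real.log_two_gt_d9
  have hρ0 : 0 < ρ := lt_of_lt_of_le (by positivity) hρ
  have hu0 : 0 ≤ u := by linarith
  have h1 : f ≤ 2 * (p + L * (4 / n)) + ρ * s * L * u := by
    have := mul_le_mul_of_nonneg_right hk hu0
    linarith
  have h2 : (1 / (L:ℝ)) * f ≤ 2 * ((1 / (L:ℝ)) * p) + 8 * (n:ℝ)⁻¹ + ρ * s * u := by
    calc (1 / (L:ℝ)) * f ≤ (1 / (L:ℝ)) * (2 * (p + L * (4 / n)) + ρ * s * L * u) := by gcongr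
      _ = _ := by field_simp; ring
  have hps : 0 < ρ * s := by positivity
  have h3 : (n:ℝ)⁻¹ ≤ ρ * s * t * (2 * ℓ) := by
    calc (n:ℝ)⁻¹ ≤ ρ * 1 * 1 * 1 := by linarith
      _ ≤ ρ * s * t * (2 * ℓ) := by gcongr; linarith
  have h4 : u ≤ t * (49 + 12 * c) * ℓ + d := by
    have : ℓ ≤ t * ℓ := by nlinarith
    rw [hu]; nlinarith
  have h5 : ρ * s * u ≤ ρ * s * (t * (49 + 12 * c) * ℓ + d) := by gcongr
  have hP : 0 ≤ (1 / (L:ℝ)) * p := by positivity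
  have hX : 0 ≤ ρ * s * t * ℓ := mul_nonneg (by positivity) (by linarith)
  have hD : 0 ≤ ρ * s * d := by positivity
  have hcP := mul_nonneg hc.le hP
  have hcD := mul_nonneg hc.le hD
  nlinarith

set_option maxHeartbeats 2000000 in
/-- Sparse activation concentration, uniform version.  Fix `c > 0`.  There is a constant
`C > 0` depending only on `c` such that: for any `n ≥ 2`, `L ≥ 1`, `s ≥ 1`, `ρ ∈ [1/n, 1]`,
any nonnegative `L × n` matrix `G` with unit-ℓ2-norm `s`-sparse rows and columns having at
most `ρL` nonzero entries, any `1 ≤ t ≤ n^c`, fixed `ϑ ∈ ℝ^{t+1}`, `ς ∈ ℝ_{≥0}^L`, and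
i.i.d. standard Gaussian vectors `z_{-1}, …, z_{t-1}` in `ℝ^n` (modelled by the product
Gaussian measure on `Fin (t+1) → Fin n → ℝ`), for every `δ ∈ (exp(-n/4), 1)`, with
probability at least `1 - δ`, simultaneously for every unit vector `α ∈ 𝕊^t` and every
`b ∈ ℝ`, writing `y = Σ_τ α_τ z_τ` and `b_l = b - ς_l·(αᵀϑ)`,
`(1/L)·Σ_l 1{g_lᵀy > b_l}
  ≤ C·((1/L)·Σ_l Φ(b_l) + ρ·s·t·log(n(1+‖ς‖_∞‖ϑ‖_∞)) + ρ·s·log(1/δ))`. -/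
theorem sparse_activation_uniform (c : ℝ) (hc : 0 < c) :
    ∃ C : ℝ, 0 < C ∧
      ∀ (n L s : ℕ), 2 ≤ n → 1 ≤ L → 1 ≤ s →
      ∀ ρ : ℝ, (n : ℝ)⁻¹ ≤ ρ → ρ ≤ 1 →
      ∀ G : Fin L → Fin n → ℝ,
        (∀ l i, 0 ≤ G l i) →
        (∀ l, Real.sqrt (∑ i, G l i ^ 2) = 1) →
        (∀ l, (Function.support (G l)).ncard ≤ s) →
        (∀ i : Fin n, ((Function.support fun l => G l i).ncard : ℝ) ≤ ρ * L) →
      ∀ t : ℕ, 1 ≤ t → (t : ℝ) ≤ (n : ℝ) ^ c →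
      ∀ ϑ : Fin (t + 1) → ℝ, ∀ ς : Fin L → ℝ, (∀ l, 0 ≤ ς l) →
      ∀ δ : ℝ, Real.exp (-(n : ℝ) / 4) < δ → δ < 1 →
        ENNReal.ofReal (1 - δ) ≤
          (Measure.pi fun _ : Fin (t + 1) =>
              (Measure.pi fun _ : Fin n => gaussianReal 0 1))
            {z | ∀ α : Fin (t + 1) → ℝ, (∑ τ, α τ ^ 2) = 1 → ∀ b : ℝ,
              (1 / (L : ℝ)) *
                  (∑ l, if b - ς l * (∑ τ, α τ * ϑ τ) <
                      ∑ i, G l i * ∑ τ, α τ * z τ i then (1 : ℝ) else 0) ≤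
                C * ((1 / (L : ℝ)) * ∑ l, gaussTail (b - ς l * (∑ τ, α τ * ϑ τ)) +
                    ρ * s * t * Real.log ((n : ℝ) * (1 + (⨆ l, |ς l|) * ⨆ τ, |ϑ τ|)) +
                    ρ * s * Real.log δ⁻¹)} := by
  refine ⟨100 + 12 * c, by linarith, ?_⟩
  intro n L s hn hL hs ρ hρ hρ1 G hG0 hG hsup hcol t ht htn ϑ ς hς δ hδ hδ1
  have hn' : (2 : ℝ) ≤ n := by exact_mod_cast hn
  have ht' : (1 : ℝ) ≤ t := by exact_mod_cast ht
  have hL' : (1 : ℝ) ≤ L := by exact_mod_cast hL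
  have hρ0 : 0 < ρ := lt_of_lt_of_le (by positivity) hρ
  have hδ0 : 0 < δ := (Real.exp_pos _).trans hδ
  have hG2 : ∀ l, ∑ i, G l i ^ 2 = 1 := fun l => by
    have := hG l
    rwa [Real.sqrt_eq_one] at this
  have hG1 : ∀ l i, |G l i| ≤ 1 := by
    intro l i
    rw [← sq_le_one_iff_abs_le_one, ← hG2 l]
    exact Finset.single_le_sum (f := fun i => G l i ^ 2) (fun j _ => sq_nonneg _) (Finset.mem_univ i)
  set A : ℝ := ⨆ l, |ς l| with hA
  set D : ℝ := ⨆ τ, |ϑ τ| with hD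
  have hςA : ∀ l, |ς l| ≤ A := fun l =>
    le_ciSup (f := fun l => |ς l|) (Set.finite_range _).bddAbove l
  have hϑD : ∀ τ, |ϑ τ| ≤ D := fun τ =>
    le_ciSup (f := fun τ => |ϑ τ|) (Set.finite_range _).bddAbove τ
  have hA0 : 0 ≤ A := (abs_nonneg _).trans (hςA ⟨0, hL⟩)
  have hD0 : 0 ≤ D := (abs_nonneg _).trans (hϑD 0)
  set Q : ℝ := A * D with hQdef
  have hQ : 0 ≤ Q := mul_nonneg hA0 hD0
  obtain ⟨k, hk1, hk, hev⟩ := sa_event n L s hL ρ G hG2 hsup hcol hρ0.le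
  set T : ℝ := (t : ℝ) + 1 with hT
  have hT1 : 2 ≤ T := by linarith
  set B : ℝ := 4 * n ^ 2 * T ^ 2 * (1 + Q) with hB
  set ε : ℝ := 1 / (4 * n ^ 3 * T ^ 2 * (1 + Q)) with hε
  have hε0 : 0 < ε := by positivity
  have hBε : B * ε = 1 / n := by rw [hB, hε]; field_simp
  have hBdε : B / ε = 16 * (n:ℝ)^5 * T^4 * (1+Q)^2 := by rw [hB, hε]; field_simp; ring
  have hnT : 1 ≤ (n:ℝ)^2 * T^2 := one_le_mul_of_one_le_of_one_le
    (one_le_pow₀ (by linarith)) (one_le_pow₀ (by linarith))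
  have hB1 : 4 ≤ B := by rw [hB]; nlinarith
  have hTn : T ≤ 4 * n^2 * T^2 := by
    have : T ≤ T^2 := by nlinarith
    have : T^2 ≤ (n:ℝ)^2 * T^2 :=
      le_mul_of_one_le_left (sq_nonneg T) (one_le_pow₀ (by linarith))
    linarith [sq_nonneg T]
  have hBsum : 4 * (n:ℝ)^2 * T^2 + T * Q ≤ B := by
    have h1 := mul_le_mul_of_nonneg_right hTn hQ
    rw [hB, mul_add, mul_one]; linarith
  have hε1 : ε ≤ 1 / n := by
    rw [← hBε]; exact le_mul_of_one_le_left hε0.le (by linarith)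
  have hBsumε : 4 * (n:ℝ)^2 * T^2 * ε + T * ε * Q ≤ 1 / n := by
    have h1 := mul_le_mul_of_nonneg_right hBsum hε0.le
    rw [← hBε]; linarith
  set m : ℕ := ⌈B / ε⌉₊ with hm
  have hBm : B / ε ≤ m := Nat.le_ceil _
  have hmB : (m : ℝ) ≤ 16 * (n:ℝ)^5 * T^4 * (1+Q)^2 + 1 := by
    rw [← hBdε]; exact (Nat.ceil_lt_add_one (by positivity)).le
  set ℓ : ℝ := Real.log ((n : ℝ) * (1 + Q)) with hℓ
  have hℓ2 : Real.log 2 ≤ ℓ := Real.log_le_log (by norm_num) (by nlinarith)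
  have hl20 : 0 < Real.log 2 := Real.log_pos (by norm_num)
  have hlogN := sa_logN c hc n t m hn ht htn Q hQ hmB
  set N : ℝ := ((2 * m + 1 : ℕ) : ℝ) ^ (t + 2) with hN
  have hN1 : 1 ≤ N := one_le_pow₀ (by push_cast; linarith [Nat.cast_nonneg (α := ℝ) m])
  have hN0 : 0 < N := by linarith
  have hlogN0 : 0 ≤ Real.log N := Real.log_nonneg hN1
  have hd : 0 ≤ Real.log δ⁻¹ := Real.log_nonneg ((one_le_inv₀ hδ0).2 hδ1.le)
  set u : ℝ := Real.log 2 + Real.log N + Real.log δ⁻¹ with hu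
  have hexpu : Real.exp (-u) = δ / 2 / N := by
    rw [hu, ← Real.log_mul (by norm_num) (by positivity), ← Real.log_mul (by positivity) (by positivity),
      Real.exp_neg, Real.exp_log (by positivity)]
    field_simp
  let Good : (Fin (t+1) → Fin n → ℝ) → Prop := fun z => ∀ τ i, |z τ i| ≤ 4 * n * T
  let Ineq : (Fin (t+1) → ℝ) → ℝ → (Fin (t+1) → Fin n → ℝ) → Prop := fun α b z =>
    (1 / (L : ℝ)) * (∑ l, if b - ς l * (∑ τ, α τ * ϑ τ) <
        ∑ i, G l i * ∑ τ, α τ * z τ i then (1 : ℝ) else 0) ≤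
      (100 + 12 * c) * ((1 / (L : ℝ)) * ∑ l, gaussTail (b - ς l * (∑ τ, α τ * ϑ τ)) +
        ρ * s * t * ℓ + ρ * s * Real.log δ⁻¹)
  let I : Finset ℤ := Finset.Icc (-(m:ℤ)) m
  have hcardI : Fintype.card I = 2 * m + 1 := by
    rw [Fintype.card_coe, Int.card_Icc]; omega
  let Cell : ((Fin (t+1) → I) × I) → (Fin (t+1) → ℝ) → ℝ → Prop := fun κ α b =>
    (∑ τ, α τ ^ 2) = 1 ∧ (∀ τ, ⌊α τ / ε⌋ = (κ.1 τ : ℤ)) ∧ ⌊b / ε⌋ = (κ.2 : ℤ)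
  have hclose : ∀ (x y : ℝ) (j : ℤ), ⌊x / ε⌋ = j → ⌊y / ε⌋ = j → |x - y| ≤ ε := by
    intro x y j hx hy
    have h := Int.abs_sub_lt_one_of_floor_eq_floor (hx.trans hy.symm)
    rw [← sub_div, abs_div, abs_of_pos hε0, div_lt_one hε0] at h
    exact h.le
  have hTcast : ((t + 1 : ℕ) : ℝ) = T := by push_cast; rfl
  have hcell : ∀ κ, ∃ S : Set (Fin (t+1) → Fin n → ℝ),
      (saG (t+1) n) S ≤ ENNReal.ofReal (δ / 2 / N) ∧
      ∀ α b, Cell κ α b → ∀ z, Good z → z ∉ S → Ineq α b z := by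
    intro κ
    by_cases hne : ∃ α b, Cell κ α b
    swap
    · refine ⟨∅, by simp, ?_⟩
      intro α b h
      exact absurd ⟨α, b, h⟩ hne
    obtain ⟨α', b', hα'1, hα', hb'⟩ := hne
    let β : Fin L → ℝ := fun l => b' - ς l * (∑ τ, α' τ * ϑ τ) - 2 / n
    refine ⟨_, (hev (t+1) α' hα'1 β u).trans (by rw [hexpu]), ?_⟩
    intro α b ⟨hα1, hα, hb⟩ z hz hzS
    have hzS' : (∑ l, if β l < saX (G l) α' z then (1 : ℝ) else 0) ≤
      2 * (∑ l, gaussTail (β l)) + k * u := by simpa using hzS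
    have hbb : |b - b'| ≤ ε := hclose _ _ _ hb hb'
    have hαα : ∀ τ, |α τ - α' τ| ≤ ε := fun τ => hclose _ _ _ (hα τ) (hα' τ)
    have hdot : ∀ l, |ς l * (∑ τ, α τ * ϑ τ) - ς l * (∑ τ, α' τ * ϑ τ)| ≤ T * ε * Q := by
      intro l
      have := sa_dot_bound (ς l) A D ε (fun τ => α τ - α' τ) ϑ (hςA l) hαα hϑD hε0.le
      rw [hTcast] at this
      rw [← mul_sub, ← Finset.sum_sub_distrib]
      simpa only [sub_mul] using this
    have hlin : ∀ l, |saX (G l) α z - saX (G l) α' z| ≤ 4 * (n:ℝ)^2 * T^2 * ε := by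
      intro l
      rw [saX_sub]
      have := saX_bound (G l) (fun τ => α τ - α' τ) z ε (4 * n * T) (hG1 l) hαα hz hε0.le
        (by positivity)
      rw [hTcast] at this
      refine this.trans (le_of_eq (by ring))
    have hnonneg1 : 0 ≤ 4 * (n:ℝ)^2 * T^2 * ε := by positivity
    have htail : ∑ l, gaussTail (β l) ≤
        ∑ l, gaussTail (b - ς l * (∑ τ, α τ * ϑ τ)) + L * (4 / n) := by
      calc ∑ l, gaussTail (β l) ≤ ∑ l, (gaussTail (b - ς l * (∑ τ, α τ * ϑ τ)) + 4 / n) := by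
            refine Finset.sum_le_sum fun l _ => ?_
            refine le_trans (gt_anti ?_) (gt_shift _ _ (by positivity))
            have h1 := abs_le.1 hbb
            have h2 := abs_le.1 (hdot l)
            have h3 : (4:ℝ) / n = 4 * (1 / n) := by ring
            have h4 : (2:ℝ) / n = 2 * (1 / n) := by ring
            simp only [β]
            rw [h3, h4]
            linarith [h1.1, h1.2, h2.1, h2.2]
        _ = _ := by simp [Finset.sum_add_distrib]
    have hind : (∑ l, if b - ς l * (∑ τ, α τ * ϑ τ) <
        ∑ i, G l i * ∑ τ, α τ * z τ i then (1 : ℝ) else 0) ≤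
        ∑ l, if β l < saX (G l) α' z then (1 : ℝ) else 0 := by
      refine Finset.sum_le_sum fun l _ => ?_
      by_cases hl : b - ς l * (∑ τ, α τ * ϑ τ) < ∑ i, G l i * ∑ τ, α τ * z τ i
      · have hl2 : b - ς l * (∑ τ, α τ * ϑ τ) < saX (G l) α z := hl
        have hl3 : β l < saX (G l) α' z := by
          have h1 := abs_le.1 hbb
          have h2 := abs_le.1 (hdot l)
          have h3 := abs_le.1 (hlin l)
          have h4 : (2:ℝ) / n = 2 * (1 / n) := by ring
          simp only [β]
          rw [h4]
          linarith [h1.1, h1.2, h2.1, h2.2, h3.1, h3.2]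
        rw [if_pos hl, if_pos hl3]
      · rw [if_neg hl]
        split_ifs <;> norm_num
    exact sa_arith c hc n L s t hn hL hs ht ρ hρ ℓ _ (Real.log N) u k _ _ _ hℓ2 hd hk hlogN0
      hlogN hu (Finset.sum_nonneg fun l _ => gt_nonneg _) htail (hind.trans hzS')
  choose S hS hSI using hcell
  set Bad : Set (Fin (t+1) → Fin n → ℝ) := {z | ∃ τ i, 4 * (n : ℝ) * ((t+1 : ℕ) : ℝ) < |z τ i|} ∪ ⋃ κ, S κ with hBad
  have hBadμ : (saG (t+1) n) Bad ≤ ENNReal.ofReal δ := by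
    refine (measure_union_le _ _).trans ?_
    have h1 := sa_max (t+1) n (by omega) (by omega) δ hδ
    have h2 : (saG (t+1) n) (⋃ κ, S κ) ≤ ENNReal.ofReal (δ / 2) := by
      refine (measure_iUnion_fintype_le _ _).trans ?_
      refine (Finset.sum_le_card_nsmul _ _ _ fun κ _ => hS κ).trans ?_
      rw [nsmul_eq_mul, ← ENNReal.ofReal_natCast, ← ENNReal.ofReal_mul (by positivity)]
      apply ENNReal.ofReal_le_ofReal
      rw [Finset.card_univ, Fintype.card_prod, Fintype.card_fun, hcardI, Fintype.card_fin,
        ← pow_succ, Nat.cast_pow]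
      rw [mul_div_cancel₀]
      exact hN0.ne'
    calc _ ≤ ENNReal.ofReal (δ/2) + ENNReal.ofReal (δ/2) := add_le_add h1 h2
      _ = ENNReal.ofReal δ := by
        rw [← ENNReal.ofReal_add (by positivity) (by positivity)]; congr 1; ring
  have hcompl : ENNReal.ofReal (1 - δ) ≤ (saG (t+1) n) Badᶜ := by
    have h1 : (1 : ENNReal) ≤ (saG (t+1) n) Bad + (saG (t+1) n) Badᶜ := by
      rw [← measure_univ (μ := saG (t+1) n), ← Set.union_compl_self Bad]
      exact measure_union_le _ _
    rw [ENNReal.ofReal_sub _ hδ0.le, ENNReal.ofReal_one, tsub_le_iff_left]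
    exact h1.trans (by gcongr)
  refine hcompl.trans (measure_mono ?_)
  intro z hz
  have hz1 : Good z := by
    intro τ i
    by_contra hcon
    apply hz
    left
    refine ⟨τ, i, ?_⟩
    rw [hTcast]
    exact not_le.1 hcon
  have hz2 : ∀ κ, z ∉ S κ := fun κ hκ => hz (Or.inr (Set.mem_iUnion.2 ⟨κ, hκ⟩))
  intro α hα b
  change Ineq α b z
  have hα1 : ∀ τ, |α τ| ≤ 1 := by
    intro τ
    rw [← sq_le_one_iff_abs_le_one, ← hα]
    exact Finset.single_le_sum (f := fun τ => α τ ^ 2) (fun j _ => sq_nonneg _) (Finset.mem_univ τ)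
  have hdotb : ∀ l, |ς l * (∑ τ, α τ * ϑ τ)| ≤ T * Q := by
    intro l
    have := sa_dot_bound (ς l) A D 1 α ϑ (hςA l) hα1 hϑD zero_le_one
    rw [hTcast, mul_one] at this
    exact this
  have hXb : ∀ l, |saX (G l) α z| ≤ 4 * (n:ℝ)^2 * T^2 := by
    intro l
    have := saX_bound (G l) α z 1 (4 * n * T) (hG1 l) hα1 hz1 zero_le_one (by positivity)
    rw [hTcast] at this
    exact this.trans (le_of_eq (by ring))
  have hX0 : 0 ≤ ρ * s * t * ℓ := mul_nonneg (by positivity) (by linarith)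
  have hD0 : 0 ≤ ρ * s * Real.log δ⁻¹ := by positivity
  have hP0 : 0 ≤ (1 / (L : ℝ)) * ∑ l, gaussTail (b - ς l * (∑ τ, α τ * ϑ τ)) :=
    mul_nonneg (by positivity) (Finset.sum_nonneg fun l _ => gt_nonneg _)
  by_cases hbB : B < b
  · have h0 : (∑ l, if b - ς l * (∑ τ, α τ * ϑ τ) <
        ∑ i, G l i * ∑ τ, α τ * z τ i then (1 : ℝ) else 0) = 0 := by
      refine Finset.sum_eq_zero fun l _ => if_neg ?_
      change ¬ (_ < saX (G l) α z)
      have h1 := abs_le.1 (hXb l)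
      have h2 := abs_le.1 (hdotb l)
      rw [not_lt]
      linarith [h1.1, h1.2, h2.1, h2.2]
    simp only [Ineq]
    rw [h0, mul_zero]
    exact mul_nonneg (by linarith) (by linarith)
  by_cases hbB' : b < -B
  · have h1 : (∑ l, if b - ς l * (∑ τ, α τ * ϑ τ) <
        ∑ i, G l i * ∑ τ, α τ * z τ i then (1 : ℝ) else 0) ≤ L := by
      refine (Finset.sum_le_card_nsmul _ _ (1:ℝ) fun l _ => ?_).trans (by simp)
      split_ifs <;> norm_num
    have h2 : (L : ℝ) * (1 / 2) ≤ ∑ l, gaussTail (b - ς l * (∑ τ, α τ * ϑ τ)) := by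
      calc (L : ℝ) * (1 / 2) = ∑ l : Fin L, (1 / 2 : ℝ) := by simp
        _ ≤ _ := by
          refine Finset.sum_le_sum fun l _ => gt_half ?_
          have h2 := abs_le.1 (hdotb l)
          have h3 : 0 ≤ 4 * (n:ℝ)^2 * T^2 := by positivity
          linarith [h2.1, h2.2]
    have h3 : (1 / (L:ℝ)) * (L * (1/2)) ≤ (1 / (L:ℝ)) * ∑ l, gaussTail (b - ς l * (∑ τ, α τ * ϑ τ)) := by
      gcongr
    have h4 : (1 / (L:ℝ)) * (L * (1/2)) = 1/2 := by field_simp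
    rw [h4] at h3
    simp only [Ineq]
    calc _ ≤ (1 / (L:ℝ)) * L := by gcongr
      _ = 1 := by field_simp
      _ ≤ _ := by nlinarith
  have hfl : ∀ x : ℝ, |x| ≤ B → ⌊x / ε⌋ ∈ I := by
    intro x hx
    have h1 := abs_le.1 hx
    have h2 : x / ε ≤ B / ε := by gcongr; exact h1.2
    have h3 : -(B / ε) ≤ x / ε := by rw [← neg_div]; gcongr; exact h1.1
    refine Finset.mem_Icc.2 ⟨Int.le_floor.2 (by push_cast; linarith), ?_⟩
    have h4 := Int.floor_le (x / ε)
    have h5 : ((⌊x / ε⌋ : ℤ) : ℝ) ≤ ((m : ℤ) : ℝ) := by push_cast; linarith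
    exact_mod_cast h5
  have hbabs : |b| ≤ B := abs_le.2 ⟨not_lt.1 hbB', not_lt.1 hbB⟩
  exact hSI (fun τ => ⟨⌊α τ / ε⌋, hfl _ ((hα1 τ).trans (by linarith))⟩, ⟨⌊b / ε⌋, hfl _ hbabs⟩) α b
    ⟨hα, fun τ => rfl, rfl⟩ z hz1 (hz2 _)
end

section
/- Sparse activation concentration, fixed-parameter version. There exists a universal constant C > 0 with the following property. Let n ≥ 2, L ≥ 1, s ≥ 1 be integers, ρ ∈ [1/n, 1], and t ≥ 1. Let G be an L×n matrix with nonnegative entries whose rows g_1,…,g_L satisfy ‖g_l‖₂ = 1 and ‖g_l‖₀ ≤ s, and whose columns satisfy ‖G_{:,i}‖₀ ≤ ρL for every i. Fix a vector α = (α_{−1},…,α_{t−1}) on the unit sphere of ℝ^{t+1}, real numbers b_1, …, b_L, and let z_{−1},…,z_{t−1} be i.i.d. standard Gaussian vectors in ℝ^n. Then for every δ ∈ (0,1), with probability at least 1 − δ, writing y = Σ_{τ=−1}^{t−1} α_τ z_τ, one has (1/L) Σ_{l=1}^L 1{g_l^⊤ y > b_l} ≤ C·( (1/L) Σ_{l=1}^L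 Φ(b_l) + ρ s log(1/δ) ). -/
open MeasureTheory ProbabilityTheory

lemma sa_coloring {L k : ℕ} (hk : 0 < k) (R : Fin L → Fin L → Prop) [DecidableRel R]
    (hs : ∀ l m, R l m → R m l) (hr : ∀ l, R l l)
    (h : ∀ l, (Finset.univ.filter (R l)).card ≤ k) :
    ∃ c : Fin L → Fin k, ∀ l m, l ≠ m → R l m → c l ≠ c m := by
  classical
  have key : ∀ S : Finset (Fin L), ∃ c : Fin L → Fin k,
      ∀ l ∈ S, ∀ m ∈ S, l ≠ m → R l m → c l ≠ c m := by
    intro S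
    induction S using Finset.induction_on with
    | empty => exact ⟨fun _ => ⟨0, hk⟩, by simp⟩
    | insert a S ha ih =>
      obtain ⟨c, hc⟩ := ih
      have hcard : ((S.filter (R a)).image c).card < (Finset.univ : Finset (Fin k)).card := by
        calc ((S.filter (R a)).image c).card ≤ (S.filter (R a)).card := Finset.card_image_le
          _ < (Finset.univ.filter (R a)).card := by
            apply Finset.card_lt_card
            rw [Finset.ssubset_iff_of_subset
              (Finset.filter_subset_filter _ (Finset.subset_univ _))]
            exact ⟨a, by simp [hr], by simp [ha]⟩
          _ ≤ k := h a
          _ = _ := by simp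
      obtain ⟨q, -, hq⟩ := Finset.exists_mem_notMem_of_card_lt_card hcard
      have hq' : ∀ m ∈ S, R a m → c m ≠ q := by
        intro m hm hR he
        exact hq (Finset.mem_image.2 ⟨m, by simp [hm, hR], he⟩)
      refine ⟨Function.update c a q, ?_⟩
      intro l hl m hm hlm hR
      rw [Finset.mem_insert] at hl hm
      rcases hl with rfl | hl <;> rcases hm with rfl | hm
      · exact absurd rfl hlm
      · rw [Function.update_self, Function.update_of_ne hlm.symm]
        exact (hq' m hm hR).symm
      · rw [Function.update_self, Function.update_of_ne hlm]
        exact hq' l hl (hs _ _ hR)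
      · have h1 : l ≠ a := fun e => ha (e ▸ hl)
        have h2 : m ≠ a := fun e => ha (e ▸ hm)
        rw [Function.update_of_ne h1, Function.update_of_ne h2]
        exact hc l hl m hm hlm hR
  obtain ⟨c, hc⟩ := key Finset.univ
  exact ⟨c, fun l m => hc l (Finset.mem_univ _) m (Finset.mem_univ _)⟩

/-- tail identity -/
lemma sa_tail (b : ℝ) : (gaussianReal 0 1).real (Set.Ioi b) = gaussTail b := by
  rw [Measure.real, gaussianReal_apply_eq_integral 0 one_ne_zero, ENNReal.toReal_ofReal]
  · unfold gaussTail
    congr 1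
    ext u
    simp [gaussianPDFReal]
    ring
  · exact integral_nonneg (fun x => gaussianPDFReal_nonneg _ _ _)

section
variable {Ω : Type*} [MeasurableSpace Ω] {P : Measure Ω}

lemma sa_bound_int [IsFiniteMeasure P] {f : Ω → ℝ} (hf : Measurable f) (B : ℝ)
    (h : ∀ ω, f ω ≤ B) : Integrable (fun ω => Real.exp (f ω)) P := by
  refine Integrable.of_bound (by fun_prop) (Real.exp B) (ae_of_all _ fun ω => ?_)
  rw [Real.norm_eq_abs, abs_of_pos (Real.exp_pos _)]
  exact Real.exp_le_exp.2 (h ω)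

lemma sa_mgf_one [IsProbabilityMeasure P] {X : Ω → ℝ} (hX : Measurable X) (b : ℝ) :
    mgf (fun ω => if b < X ω then (1 : ℝ) else 0) P 1
      ≤ Real.exp ((Real.exp 1 - 1) * P.real {ω | b < X ω}) := by
  have hm : MeasurableSet {ω | b < X ω} := measurableSet_lt measurable_const hX
  have e : ∀ ω, Real.exp (1 * (if b < X ω then (1 : ℝ) else 0))
      = 1 + (Real.exp 1 - 1) * Set.indicator {ω | b < X ω} (fun _ => (1 : ℝ)) ω := by
    intro ω
    by_cases h : b < X ω <;> simp [h]
  unfold mgf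
  simp_rw [e]
  rw [integral_add (integrable_const _)
    (((integrable_const (1 : ℝ)).indicator hm).const_mul _), integral_const_mul,
    integral_indicator_const _ hm]
  simp only [integral_const, probReal_univ, smul_eq_mul, mul_one]
  linarith [Real.add_one_le_exp ((Real.exp 1 - 1) * P.real {ω | b < X ω})]

lemma sa_chernoff [IsProbabilityMeasure P] {L k : ℕ} (hk : 0 < k) (c : Fin L → Fin k)
    (X : Fin L → Ω → ℝ) (hX : ∀ l, Measurable (X l)) (b : Fin L → ℝ)
    (hind : ∀ j : Fin k, iIndepFun (fun (l : {l // c l = j}) => X l) P) :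
    ∫ ω, Real.exp ((k : ℝ)⁻¹ * ((∑ l, if b l < X l ω then (1 : ℝ) else 0)
      - (Real.exp 1 - 1) * ∑ l, P.real {ω | b l < X l ω})) ∂P ≤ 1 := by
  classical
  set f : Fin L → Ω → ℝ := fun l ω => if b l < X l ω then (1 : ℝ) else 0 with hf
  have hfm : ∀ l, Measurable (f l) := fun l =>
    Measurable.ite (measurableSet_lt measurable_const (hX l)) measurable_const measurable_const
  have hf1 : ∀ l ω, f l ω ≤ 1 := by
    intro l ω; simp only [hf]; split_ifs <;> norm_num
  set p : Fin L → ℝ := fun l => (Real.exp 1 - 1) * P.real {ω | b l < X l ω} with hp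
  have hp0 : ∀ l, 0 ≤ p l := fun l =>
    mul_nonneg (by linarith [Real.add_one_le_exp (1 : ℝ)]) measureReal_nonneg
  let S : Fin k → Ω → ℝ := fun j ω => ∑ l : {l // c l = j}, (f l ω - p l)
  have hSm : ∀ j, Measurable (S j) := fun j => by
    have := hfm
    fun_prop
  have hSB : ∀ j ω, S j ω ≤ ∑ l : {l // c l = j}, (1 : ℝ) := fun j ω =>
    Finset.sum_le_sum fun l _ => by linarith [hf1 l ω, hp0 l]
  have hSint : ∀ j, Integrable (fun ω => Real.exp (S j ω)) P := fun j =>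
    sa_bound_int (hSm j) _ (hSB j)
  have hS1 : ∀ j, ∫ ω, Real.exp (S j ω) ∂P ≤ 1 := by
    intro j
    have hindf : iIndepFun (fun (l : {l // c l = j}) => f l) P := by
      have := (hind j).comp (fun l x => if b l < x then (1 : ℝ) else 0)
        (fun l => Measurable.ite measurableSet_Ioi measurable_const measurable_const)
      exact this
    have h1 := hindf.mgf_sum (t := 1) (fun l => hfm l) Finset.univ
    have h2 : ∀ ω, Real.exp (S j ω) =
        Real.exp (1 * (∑ l : {l // c l = j}, f l) ω) * Real.exp (- ∑ l : {l // c l = j}, p l) := by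
      intro ω
      rw [← Real.exp_add]
      simp only [S, Finset.sum_sub_distrib, Finset.sum_apply]
      ring_nf
    simp_rw [h2]
    rw [integral_mul_const]
    change mgf (∑ l : {l // c l = j}, f l) P 1 * _ ≤ 1
    rw [h1]
    calc _ ≤ (∏ l : {l // c l = j}, Real.exp (p l)) * Real.exp (- ∑ l : {l // c l = j}, p l) := by
          gcongr with l
          · intro l _; exact mgf_nonneg
          · exact sa_mgf_one (hX l) (b l)
      _ = 1 := by rw [← Real.exp_sum, ← Real.exp_add]; simp
  have hsum : ∀ ω, (∑ l, f l ω) - (Real.exp 1 - 1) * ∑ l, P.real {ω | b l < X l ω}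
      = ∑ j, S j ω := by
    intro ω
    rw [Finset.mul_sum, ← Finset.sum_sub_distrib]
    simp only [S]
    rw [← Fintype.sum_fiberwise c (fun l => f l ω - p l)]
  have hkR : (0 : ℝ) < k := by exact_mod_cast hk
  have hjen : ∀ ω, Real.exp ((k : ℝ)⁻¹ * ∑ j, S j ω) ≤ (k : ℝ)⁻¹ * ∑ j, Real.exp (S j ω) := by
    intro ω
    have := convexOn_exp.map_sum_le (t := (Finset.univ : Finset (Fin k)))
      (w := fun _ => (k : ℝ)⁻¹) (p := fun j => S j ω) (fun _ _ => by positivity)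
      (by simp [hkR.ne']) (fun _ _ => Set.mem_univ _)
    simpa [Finset.mul_sum] using this
  change ∫ ω, Real.exp ((k : ℝ)⁻¹ * ((∑ l, f l ω)
      - (Real.exp 1 - 1) * ∑ l, P.real {ω | b l < X l ω})) ∂P ≤ 1
  simp_rw [hsum]
  calc _ ≤ ∫ ω, (k : ℝ)⁻¹ * ∑ j, Real.exp (S j ω) ∂P := by
        apply integral_mono_of_nonneg (ae_of_all _ fun _ => (Real.exp_pos _).le)
          ((integrable_finsetSum _ fun j _ => hSint j).const_mul _) (ae_of_all _ hjen)
    _ = (k : ℝ)⁻¹ * ∑ j, ∫ ω, Real.exp (S j ω) ∂P := by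
        rw [integral_const_mul, integral_finsetSum _ fun j _ => hSint j]
    _ ≤ (k : ℝ)⁻¹ * ∑ j : Fin k, (1 : ℝ) := by
        gcongr with j; exact hS1 j
    _ = 1 := by simp [hkR.ne']

lemma sa_markov [IsProbabilityMeasure P] {W : Ω → ℝ} (hW : Measurable W) {B : ℝ}
    (hB : ∀ ω, W ω ≤ B)
    (h : ∫ ω, Real.exp (W ω) ∂P ≤ 1) {δ : ℝ} (hδ : 0 < δ) :
    ENNReal.ofReal (1 - δ) ≤ P {ω | W ω ≤ Real.log δ⁻¹} := by
  have hm : MeasurableSet {ω | W ω ≤ Real.log δ⁻¹} := measurableSet_le hW measurable_const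
  have h1 := mul_meas_ge_le_integral_of_nonneg
    (ae_of_all P fun ω => (Real.exp_pos (W ω)).le) (sa_bound_int hW B hB) δ⁻¹
  have h2 : P.real {ω | W ω ≤ Real.log δ⁻¹}ᶜ ≤ δ := by
    have h3 : P.real {ω | W ω ≤ Real.log δ⁻¹}ᶜ ≤ P.real {ω | δ⁻¹ ≤ Real.exp (W ω)} := by
      apply measureReal_mono
      · intro ω hω
        simp only [Set.mem_compl_iff, Set.mem_ofPred_eq, not_le] at hω ⊢
        have := Real.exp_le_exp.2 hω.le
        rwa [Real.exp_log (by positivity)] at this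
      · exact measure_ne_top _ _
    have h4 : δ⁻¹ * P.real {ω | δ⁻¹ ≤ Real.exp (W ω)} ≤ 1 := le_trans h1 h
    rw [inv_mul_le_iff₀ hδ, mul_one] at h4
    exact h3.trans h4
  rw [probReal_compl_eq_one_sub hm] at h2
  rw [← ofReal_measureReal]
  exact ENNReal.ofReal_le_ofReal (by linarith)

variable {κ : Type*} [Fintype κ] {ξ : κ → Ω → ℝ}

lemma sa_cov_s1 (hi : iIndepFun ξ P) (hl : ∀ p, HasLaw (ξ p) (gaussianReal 0 1) P)
    (a a' : κ → ℝ) :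
    cov[fun ω => ∑ p, a p * ξ p ω, fun ω => ∑ p, a' p * ξ p ω; P] = ∑ p, a p * a' p := by
  classical
  have := hi.isProbabilityMeasure
  have hL2 : ∀ p, MemLp (ξ p) 2 P := fun p => (hl p).hasGaussianLaw.memLp_two
  rw [covariance_fun_sum_fun_sum (fun p => (hL2 p).const_mul _) (fun p => (hL2 p).const_mul _)]
  refine Finset.sum_congr rfl fun p _ => ?_
  rw [Finset.sum_eq_single p]
  · rw [covariance_const_mul_left, covariance_const_mul_right, covariance_self (hl p).aemeasurable,
      (hl p).variance_eq, variance_id_gaussianReal]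
    simp
  · intro q _ hq
    rw [covariance_const_mul_left, covariance_const_mul_right,
      (hi.indepFun hq.symm).covariance_eq_zero (hL2 p) (hL2 q)]
    simp
  · simp

lemma sa_joint (hi : iIndepFun ξ P) (hl : ∀ p, HasLaw (ξ p) (gaussianReal 0 1) P)
    {ι : Type*} [Fintype ι] (a : ι → κ → ℝ) :
    HasGaussianLaw (fun ω (l : ι) => ∑ p, a l p * ξ p ω) P := by
  have h := hi.hasGaussianLaw (fun p => (hl p).hasGaussianLaw)
  have h' := h.map_fun (ContinuousLinearMap.pi fun l =>
    ∑ p, a l p • ContinuousLinearMap.proj (R := ℝ) (φ := fun _ : κ => ℝ) p)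
  have e : (fun ω (l : ι) => ∑ p, a l p * ξ p ω) = fun ω => (ContinuousLinearMap.pi fun l =>
    ∑ p, a l p • ContinuousLinearMap.proj (R := ℝ) (φ := fun _ : κ => ℝ) p) (ξ · ω) := by
    ext ω l
    simp [ContinuousLinearMap.sum_apply]
  rw [e]
  exact h'

lemma sa_law (hi : iIndepFun ξ P) (hl : ∀ p, HasLaw (ξ p) (gaussianReal 0 1) P)
    (a : κ → ℝ) (ha : ∑ p, a p ^ 2 = 1) :
    P.map (fun ω => ∑ p, a p * ξ p ω) = gaussianReal 0 1 := by
  have := hi.isProbabilityMeasure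
  have hg : HasGaussianLaw (fun ω => ∑ p, a p * ξ p ω) P :=
    (sa_joint hi hl (fun _ : Unit => a)).eval ()
  rw [hg.map_eq_gaussianReal]
  have h1 : ∫ ω, ∑ p, a p * ξ p ω ∂P = 0 := by
    rw [integral_finsetSum _ fun p _ => ((hl p).hasGaussianLaw.integrable.const_mul _)]
    refine Finset.sum_eq_zero fun p _ => ?_
    rw [integral_const_mul, (hl p).integral_eq]
    simp
  have h2 : Var[fun ω => ∑ p, a p * ξ p ω; P] = 1 := by
    rw [← covariance_self hg.aemeasurable, sa_cov_s1 hi hl, ← ha]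
    simp_rw [sq]
  rw [h1, h2]
  simp

end

lemma sa_indep (t n : ℕ) :
    iIndepFun (fun (p : Fin (t + 1) × Fin n) (z : Fin (t + 1) → Fin n → ℝ) => z p.1 p.2)
      (Measure.pi fun _ : Fin (t + 1) => (Measure.pi fun _ : Fin n => gaussianReal 0 1)) := by
  have := iIndepFun_uncurry_infinitePi' (ι := Fin (t+1)) (κ := Fin n)
    (X := fun _ _ (x : ℝ) => x)
    (fun _ _ => gaussianReal 0 1) (fun _ _ => measurable_id)
  simpa [Measure.infinitePi_eq_pi] using this

lemma sa_marg (t n : ℕ) (p : Fin (t + 1) × Fin n) :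
    HasLaw (fun (z : Fin (t + 1) → Fin n → ℝ) => z p.1 p.2) (gaussianReal 0 1)
      (Measure.pi fun _ : Fin (t + 1) => (Measure.pi fun _ : Fin n => gaussianReal 0 1)) := by
  have h1 := measurePreserving_eval (fun _ : Fin (t + 1) =>
    (Measure.pi fun _ : Fin n => gaussianReal 0 1)) p.1
  have h2 := measurePreserving_eval (fun _ : Fin n => gaussianReal 0 1) p.2
  have h3 := h2.comp h1
  exact ⟨h3.measurable.aemeasurable, h3.map_eq⟩

/-- Sparse activation concentration, fixed-parameter version.  There is a universal constant
`C > 0` such that for any `n ≥ 2`, `L ≥ 1`, `s ≥ 1`, `ρ ∈ [1/n, 1]`, any nonnegative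
`L × n` matrix `G` with unit-ℓ2-norm `s`-sparse rows and columns with at most `ρL` nonzero
entries, any fixed unit vector `α ∈ 𝕊^t`, fixed biases `b : Fin L → ℝ`, and
i.i.d. standard Gaussian vectors `z_{-1}, …, z_{t-1}` in `ℝ^n` (modelled by the product
Gaussian measure on `Fin (t+1) → Fin n → ℝ`), for every `δ ∈ (0,1)`, with probability at
least `1 - δ`, writing `y = Σ_τ α_τ z_τ`,
`(1/L)·Σ_l 1{g_lᵀy > b_l} ≤ C·((1/L)·Σ_l Φ(b_l) + ρ·s·log(1/δ))`. -/
theorem sparse_activation_fixed :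
    ∃ C : ℝ, 0 < C ∧
      ∀ (n L s : ℕ), 2 ≤ n → 1 ≤ L → 1 ≤ s →
      ∀ ρ : ℝ, (n : ℝ)⁻¹ ≤ ρ → ρ ≤ 1 →
      ∀ G : Fin L → Fin n → ℝ,
        (∀ l i, 0 ≤ G l i) →
        (∀ l, Real.sqrt (∑ i, G l i ^ 2) = 1) →
        (∀ l, (Function.support (G l)).ncard ≤ s) →
        (∀ i : Fin n, ((Function.support fun l => G l i).ncard : ℝ) ≤ ρ * L) →
      ∀ t : ℕ, 1 ≤ t →
      ∀ α : Fin (t + 1) → ℝ, (∑ τ, α τ ^ 2) = 1 →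
      ∀ b : Fin L → ℝ,
      ∀ δ : ℝ, 0 < δ → δ < 1 →
        ENNReal.ofReal (1 - δ) ≤
          (Measure.pi fun _ : Fin (t + 1) =>
              (Measure.pi fun _ : Fin n => gaussianReal 0 1))
            {z | (1 / (L : ℝ)) *
                  (∑ l, if b l < ∑ i, G l i * ∑ τ, α τ * z τ i then (1 : ℝ) else 0) ≤
                C * ((1 / (L : ℝ)) * ∑ l, gaussTail (b l) + ρ * s * Real.log δ⁻¹)} := by
  classical
  refine ⟨2, by norm_num, ?_⟩
  intro n L s hn hL hs ρ hρ hρ1 G hG0 hG1 hrow hcol t ht α hα b δ hδ hδ1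
  set P := (Measure.pi fun _ : Fin (t + 1) =>
              (Measure.pi fun _ : Fin n => gaussianReal 0 1)) with hP
  have hLR : (0 : ℝ) < L := by exact_mod_cast hL
  have hnorm : ∀ l, ∑ i, G l i ^ 2 = 1 := fun l => by
    have := hG1 l
    rwa [Real.sqrt_eq_one] at this
  let R : Fin L → Fin L → Prop := fun l m => ∃ i, G l i ≠ 0 ∧ G m i ≠ 0
  have hRr : ∀ l, R l l := by
    intro l
    by_contra hc
    have h0 : ∀ i, G l i = 0 := fun i => by
      by_contra h
      exact hc ⟨i, h, h⟩
    have := hnorm l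
    simp [h0] at this
  have hdeg : ∀ l, ((Finset.univ.filter (R l)).card : ℝ) ≤ ρ * s * L := by
    intro l
    have hsub : Finset.univ.filter (R l) ⊆
        (Finset.univ.filter fun i => G l i ≠ 0).biUnion
          fun i => Finset.univ.filter fun m => G m i ≠ 0 := by
      intro m hm
      obtain ⟨i, h1, h2⟩ := (Finset.mem_filter.1 hm).2
      simp only [Finset.mem_biUnion, Finset.mem_filter, Finset.mem_univ, true_and]
      exact ⟨i, h1, h2⟩
    have hc1 : ((Finset.univ.filter fun i => G l i ≠ 0).card : ℝ) ≤ s := by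
      have e : (Function.support (G l)) = ((Finset.univ.filter fun i => G l i ≠ 0 : Finset _) :
        Set (Fin n)) := by ext; simp
      have := hrow l
      rw [e, Set.ncard_coe_finset] at this
      exact_mod_cast this
    have hc2 : ∀ i, ((Finset.univ.filter fun m => G m i ≠ 0).card : ℝ) ≤ ρ * L := by
      intro i
      have e : (Function.support fun m => G m i) =
        ((Finset.univ.filter fun m => G m i ≠ 0 : Finset _) : Set (Fin L)) := by ext; simp
      have := hcol i
      rwa [e, Set.ncard_coe_finset] at this
    have hρL : 0 ≤ ρ * L := by
      have : (0 : ℝ) ≤ (n : ℝ)⁻¹ := by positivity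
      exact mul_nonneg (this.trans hρ) hLR.le
    calc ((Finset.univ.filter (R l)).card : ℝ)
        ≤ (((Finset.univ.filter fun i => G l i ≠ 0).biUnion
          fun i => Finset.univ.filter fun m => G m i ≠ 0).card : ℝ) := by
          exact_mod_cast Finset.card_le_card hsub
      _ ≤ ∑ i ∈ Finset.univ.filter (fun i => G l i ≠ 0),
            ((Finset.univ.filter fun m => G m i ≠ 0).card : ℝ) := by
          exact_mod_cast Finset.card_biUnion_le
      _ ≤ ∑ i ∈ Finset.univ.filter (fun i => G l i ≠ 0), ρ * L :=
          Finset.sum_le_sum fun i _ => hc2 i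
      _ = ((Finset.univ.filter fun i => G l i ≠ 0).card : ℝ) * (ρ * L) := by
          rw [Finset.sum_const, nsmul_eq_mul]
      _ ≤ s * (ρ * L) := by gcongr
      _ = ρ * s * L := by ring
  set k := ⌊ρ * s * L⌋₊ with hkdef
  have hdegN : ∀ l, (Finset.univ.filter (R l)).card ≤ k := fun l => Nat.le_floor (hdeg l)
  have hk : 0 < k := by
    have : 0 < (Finset.univ.filter (R ⟨0, hL⟩)).card :=
      Finset.card_pos.2 ⟨⟨0, hL⟩, by simp [hRr]⟩
    exact this.trans_le (hdegN _)
  have hkle : (k : ℝ) ≤ ρ * s * L :=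
    Nat.floor_le ((Nat.cast_nonneg _).trans (hdeg ⟨0, hL⟩))
  obtain ⟨c, hc⟩ := sa_coloring hk R (fun l m ⟨i, h1, h2⟩ => ⟨i, h2, h1⟩) hRr hdegN
  let a : Fin L → Fin (t + 1) × Fin n → ℝ := fun l p => G l p.2 * α p.1
  let X : Fin L → (Fin (t + 1) → Fin n → ℝ) → ℝ := fun l z => ∑ p, a l p * z p.1 p.2
  have hXeq : ∀ l z, ∑ i, G l i * ∑ τ, α τ * z τ i = X l z := by
    intro l z
    simp only [X, a]
    rw [Fintype.sum_prod_type_right]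
    refine Finset.sum_congr rfl fun i _ => ?_
    rw [Finset.mul_sum]
    exact Finset.sum_congr rfl fun τ _ => by ring
  have hXm : ∀ l, Measurable (X l) := fun l => by fun_prop
  have hdot : ∀ l m, ∑ p, a l p * a m p = ∑ i, G l i * G m i := by
    intro l m
    simp only [a]
    rw [Fintype.sum_prod_type_right]
    refine Finset.sum_congr rfl fun i _ => ?_
    rw [← mul_one (G l i * G m i), ← hα, Finset.mul_sum]
    exact Finset.sum_congr rfl fun τ _ => by ring
  have hi := sa_indep t n
  have hl := sa_marg t n
  have hind : ∀ j : Fin k, iIndepFun (fun (l : {l // c l = j}) => X l) P := by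
    intro j
    apply HasGaussianLaw.iIndepFun_of_covariance_eq_zero
    · exact sa_joint hi hl (fun l : {l // c l = j} => a l)
    · intro l m hlm
      have h := sa_cov_s1 hi hl (a l) (a m)
      refine h.trans ?_
      rw [hdot]
      refine Finset.sum_eq_zero fun i _ => ?_
      by_contra hne
      have hne' := mul_ne_zero_iff.1 hne
      exact hc l m (fun e => hlm (Subtype.ext e)) ⟨i, hne'.1, hne'.2⟩ (l.2.trans m.2.symm)
  have htail : ∀ l, P.real {z | b l < X l z} = gaussTail (b l) := by
    intro l
    have hlaw : P.map (X l) = gaussianReal 0 1 := by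
      refine sa_law hi hl (a l) ?_
      have := hdot l l
      simp only [← sq] at this
      rw [this, hnorm]
    rw [← sa_tail, ← hlaw, map_measureReal_apply (hXm l) measurableSet_Ioi]
    rfl
  have hmain := sa_chernoff (P := P) hk c X hXm b hind
  have hkR : (0 : ℝ) < k := by exact_mod_cast hk
  have hT0 : ∀ l, 0 ≤ gaussTail (b l) := fun l => by rw [← htail]; exact measureReal_nonneg
  have he : Real.exp 1 - 1 ≤ 2 := by linarith [Real.exp_one_lt_three]
  have he0 : 0 ≤ Real.exp 1 - 1 := by linarith [Real.add_one_le_exp (1 : ℝ)]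
  have hmk := sa_markov (P := P) (B := (k : ℝ)⁻¹ * L) ?_ ?_ hmain hδ
  · refine hmk.trans (measure_mono ?_)
    intro z hz
    simp only [Set.mem_ofPred_eq] at hz ⊢
    simp_rw [hXeq]
    simp_rw [htail] at hz
    rw [inv_mul_le_iff₀ hkR] at hz
    set F := ∑ l, if b l < X l z then (1 : ℝ) else 0
    set T := ∑ l, gaussTail (b l) with hT
    have hTn : 0 ≤ T := Finset.sum_nonneg fun l _ => hT0 l
    have hlog : 0 ≤ Real.log δ⁻¹ := Real.log_nonneg ((one_le_inv₀ hδ).2 hδ1.le)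
    have h1 : F ≤ 2 * T + 2 * (ρ * s * L * Real.log δ⁻¹) := by
      have h2 := mul_le_mul_of_nonneg_right hkle hlog
      have h3 := mul_le_mul_of_nonneg_right he hTn
      have h4 : 0 ≤ k * Real.log δ⁻¹ := by positivity
      linarith
    calc 1 / (L : ℝ) * F ≤ 1 / (L : ℝ) * (2 * T + 2 * (ρ * s * L * Real.log δ⁻¹)) := by gcongr
      _ = _ := by field_simp
  · refine Measurable.const_mul (Measurable.sub_const ?_ _) _
    refine Finset.measurable_sum _ fun l _ => ?_
    exact Measurable.ite (measurableSet_lt measurable_const (hXm l)) measurable_const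
      measurable_const
  · intro z
    have h1 : (∑ l, if b l < X l z then (1 : ℝ) else 0) ≤ L := by
      calc _ ≤ ∑ l : Fin L, (1 : ℝ) := Finset.sum_le_sum fun l _ => by split_ifs <;> norm_num
        _ = L := by simp
    have h2 : 0 ≤ (Real.exp 1 - 1) * ∑ l, P.real {ω | b l < X l ω} :=
      mul_nonneg he0 (Finset.sum_nonneg fun _ _ => measureReal_nonneg)
    have h3 : 0 ≤ (k : ℝ)⁻¹ := by positivity
    exact mul_le_mul_of_nonneg_left (by linarith) h3
end

section
/- Second-moment bound for correlated truncated activations. There exists a universal constant C > 0 with the following property. Let b̄ < 0, L ≥ 1, ε ∈ (0, 1], and let φ : ℝ → ℝ be a measurable function satisfying |φ(x)| ≤ ε + L·(x + b̄)·1{x > −b̄} for all x ∈ ℝ. Then for independent standard Gaussian random variables x, z ∼ N(0,1) and any ι ∈ (0,1), E[ φ(x)·φ(ι x + √(1−ι²) z) ] ≤ C L ε + C (L² + 1) · Φ(|b̄|) · Φ( |b̄| √((1−ι)/(1+ι)) ). -/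
open MeasureTheory ProbabilityTheory

lemma aux_exp_integral (s t : ℝ) :
    Integrable (fun p : ℝ × ℝ => Real.exp (s * p.1 + t * p.2))
      ((gaussianReal 0 1).prod (gaussianReal 0 1)) ∧
    ∫ p : ℝ × ℝ, Real.exp (s * p.1 + t * p.2)
      ∂((gaussianReal 0 1).prod (gaussianReal 0 1)) = Real.exp ((s ^ 2 + t ^ 2) / 2) := by
  have hm : ∀ r : ℝ, ∫ x, Real.exp (r * x) ∂(gaussianReal 0 1) = Real.exp (r ^ 2 / 2) := by
    intro r
    have h := congrFun (mgf_id_gaussianReal (μ := 0) (v := 1)) r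
    simpa [mgf] using h
  have hi : ∀ r : ℝ, Integrable (fun x => Real.exp (r * x)) (gaussianReal 0 1) := fun r =>
    integrable_exp_mul_gaussianReal r
  simp only [Real.exp_add]
  refine ⟨(hi s).mul_prod (hi t), ?_⟩
  rw [integral_prod_mul (fun x => Real.exp (s * x)) (fun x => Real.exp (t * x)), hm, hm,
    ← Real.exp_add]
  congr 1
  ring

lemma gaussTail_lower (x : ℝ) (hx : 0 ≤ x) :
    Real.exp (-(3 / 2)) / Real.sqrt (2 * Real.pi) * (Real.exp (-(x ^ 2) / 2) / (1 + x))
      ≤ gaussTail x := by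
  have hint : Integrable (fun u : ℝ => Real.exp (-(u ^ 2) / 2) / Real.sqrt (2 * Real.pi)) := by
    have h := (integrable_exp_neg_mul_sq (b := 1 / 2) (by norm_num)).div_const
      (Real.sqrt (2 * Real.pi))
    refine h.congr (Filter.Eventually.of_forall fun u => ?_)
    simp only
    congr 2
    ring
  have h1 : ∫ u in Set.Ioc x (x + 1 / (1 + x)),
      Real.exp (-(u ^ 2) / 2) / Real.sqrt (2 * Real.pi) ≤ gaussTail x := by
    unfold gaussTail
    refine setIntegral_mono_set hint.integrableOn
      (Filter.Eventually.of_forall fun u => by positivity) ?_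
    exact Filter.Eventually.of_forall (fun u hu => hu.1)
  have hd : 0 < 1 / (1 + x) := by positivity
  have hxd : x * (1 / (1 + x)) ≤ 1 := by
    rw [mul_one_div, div_le_one (by positivity)]; linarith
  have hd1 : 1 / (1 + x) ≤ 1 := by
    rw [div_le_one (by positivity)]; linarith
  set d := 1 / (1 + x) with hdd
  have h2 : ∫ u in Set.Ioc x (x + d),
      Real.exp (-(3 / 2) + -(x ^ 2) / 2) / Real.sqrt (2 * Real.pi) ≤
      ∫ u in Set.Ioc x (x + d), Real.exp (-(u ^ 2) / 2) / Real.sqrt (2 * Real.pi) := by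
    refine setIntegral_mono_on (by simp) hint.integrableOn measurableSet_Ioc ?_
    intro u hu
    have : u ^ 2 ≤ (x + d) ^ 2 := pow_le_pow_left₀ (hx.trans hu.1.le) hu.2 2
    gcongr
    nlinarith
  refine le_trans (le_of_eq ?_) (h2.trans h1)
  rw [setIntegral_const, Real.exp_add]
  simp [hd.le]
  rw [hdd]
  ring

lemma aux_pointwise (β μ l x y : ℝ) (hμ : 0 < μ) (hl : μ ≤ l) :
    max (x - β) 0 * max (y - β) 0 ≤ 2 / μ ^ 2 * Real.exp (l * ((x + y) / 2 - β)) := by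
  rcases le_or_gt x β with h | h
  · rw [max_eq_right (by linarith), zero_mul]; positivity
  rcases le_or_gt y β with h' | h'
  · rw [max_eq_right (a := y - β) (by linarith), mul_zero]; positivity
  rw [max_eq_left (by linarith), max_eq_left (by linarith)]
  set t := (x + y) / 2 - β with ht
  have ht0 : 0 ≤ t := by rw [ht]; linarith
  have h1 : (x - β) * (y - β) ≤ t ^ 2 := by
    rw [ht]; nlinarith [sq_nonneg (x - y)]
  have h2 := Real.quadratic_le_exp_of_nonneg (mul_nonneg hμ.le ht0)
  have h3 : Real.exp (μ * t) ≤ Real.exp (l * t) := by gcongr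
  have h4 : 0 ≤ μ * t := by positivity
  have h5 : t ^ 2 ≤ 2 / μ ^ 2 * Real.exp (l * t) := by
    rw [div_mul_eq_mul_div, le_div_iff₀ (by positivity)]
    nlinarith
  exact h1.trans h5

lemma aux_trunc (β x : ℝ) (hβ : 0 < β) : max (x - β) 0 ≤ Real.exp x := by
  apply max_le _ (Real.exp_pos x).le
  have := Real.add_one_le_exp x
  linarith

set_option maxHeartbeats 2000000 in
/-- Second-moment bound for correlated truncated activations: there is a universal constant
`C > 0` such that for any `b̄ < 0`, `L ≥ 1`, `ε ∈ (0,1]`, any measurable `φ` with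
`|φ(x)| ≤ ε + L(x+b̄)1{x>-b̄}`, any correlation `ι ∈ (0,1)`, and independent standard
Gaussians `x, z`,
`E[φ(x)·φ(ιx+√(1-ι²)z)] ≤ CLε + C(L²+1)·Φ(|b̄|)·Φ(|b̄|√((1-ι)/(1+ι)))`. -/
theorem correlated_truncated_second_moment :
    ∃ C : ℝ, 0 < C ∧
      ∀ (b L ε : ℝ) (φ : ℝ → ℝ), b < 0 → 1 ≤ L → 0 < ε → ε ≤ 1 →
        Measurable φ →
        (∀ x : ℝ, |φ x| ≤ ε + L * (x + b) * (if -b < x then (1 : ℝ) else 0)) →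
        ∀ ι : ℝ, 0 < ι → ι < 1 →
          (∫ p : ℝ × ℝ, φ p.1 * φ (ι * p.1 + Real.sqrt (1 - ι ^ 2) * p.2)
              ∂((gaussianReal 0 1).prod (gaussianReal 0 1))) ≤
            C * L * ε + C * (L ^ 2 + 1) * gaussTail |b| *
              gaussTail (|b| * Real.sqrt ((1 - ι) / (1 + ι))) := by
  refine ⟨4 * Real.pi * Real.exp 4 + 7, by positivity, ?_⟩
  intro b L ε φ hb hL hε hε1 hφ hbd ι hι hι1
  obtain ⟨β, rfl⟩ : ∃ β, b = -β := ⟨-b, by ring⟩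
  have hβ : 0 < β := by linarith
  rw [abs_neg, abs_of_pos hβ]
  have hbd' : ∀ x, |φ x| ≤ ε + L * max (x - β) 0 := by
    intro x
    refine (hbd x).trans (le_of_eq ?_)
    rw [neg_neg]
    split_ifs with h
    · rw [max_eq_left (by linarith)]; ring
    · rw [max_eq_right (by linarith)]; ring
  set σ := Real.sqrt (1 - ι ^ 2) with hσ
  have hσ2 : σ ^ 2 = 1 - ι ^ 2 := Real.sq_sqrt (by nlinarith)
  set μ := 1 + β with hμ
  have hμ0 : 0 < μ := by positivity
  set l := 2 * μ / (1 + ι) with hl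
  have hlμ : μ ≤ l := by
    rw [hl, le_div_iff₀ (by positivity)]; nlinarith
  set P := (gaussianReal 0 1).prod (gaussianReal 0 1) with hP
  set K := 2 / μ ^ 2 * Real.exp (-(l * β)) with hK
  -- dominating function
  let G : ℝ × ℝ → ℝ := fun p => ε ^ 2 + (ε * L * Real.exp (1 * p.1 + 0 * p.2) +
    (ε * L * Real.exp (ι * p.1 + σ * p.2) +
      L ^ 2 * K * Real.exp (μ * p.1 + (l * σ / 2) * p.2)))
  have hfG : ∀ p : ℝ × ℝ, |φ p.1 * φ (ι * p.1 + σ * p.2)| ≤ G p := by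
    intro p
    set x := p.1
    set y := ι * p.1 + σ * p.2 with hy
    have e1 : |φ x * φ y| ≤ (ε + L * max (x - β) 0) * (ε + L * max (y - β) 0) := by
      rw [abs_mul]
      exact mul_le_mul (hbd' x) (hbd' y) (abs_nonneg _) ((abs_nonneg _).trans (hbd' x))
    have e2 := aux_pointwise β μ l x y hμ0 hlμ
    have e3 := aux_trunc β x hβ
    have e4 := aux_trunc β y hβ
    have e5 : 2 / μ ^ 2 * Real.exp (l * ((x + y) / 2 - β)) =
        K * Real.exp (μ * p.1 + (l * σ / 2) * p.2) := by
      rw [hK, mul_assoc, ← Real.exp_add]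
      congr 2
      have : μ = l * (1 + ι) / 2 := by rw [hl]; field_simp
      rw [this, hy]
      ring
    rw [e5] at e2
    have e6 := mul_le_mul_of_nonneg_left e2 (sq_nonneg L)
    have e7 := mul_le_mul_of_nonneg_left e3 (show 0 ≤ ε * L by positivity)
    have e8 := mul_le_mul_of_nonneg_left e4 (show 0 ≤ ε * L by positivity)
    have e9 : 1 * p.1 + 0 * p.2 = x := by simp [x]
    simp only [G]
    rw [e9]
    refine e1.trans ?_
    nlinarith
  obtain ⟨i1, v1⟩ := aux_exp_integral 1 0
  obtain ⟨i2, v2⟩ := aux_exp_integral ι σ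
  obtain ⟨i3, v3⟩ := aux_exp_integral μ (l * σ / 2)
  rw [← hP] at i1 v1 i2 v2 i3 v3
  have j1 := i1.const_mul (ε * L)
  have j2 := i2.const_mul (ε * L)
  have j3 := i3.const_mul (L ^ 2 * K)
  have j4 : Integrable (fun p : ℝ × ℝ => ε * L * Real.exp (ι * p.1 + σ * p.2) +
      L ^ 2 * K * Real.exp (μ * p.1 + (l * σ / 2) * p.2)) P := j2.add j3
  have j5 : Integrable (fun p : ℝ × ℝ => ε * L * Real.exp (1 * p.1 + 0 * p.2) +
      (ε * L * Real.exp (ι * p.1 + σ * p.2) +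
      L ^ 2 * K * Real.exp (μ * p.1 + (l * σ / 2) * p.2))) P := j1.add j4
  have hG : Integrable G P := (integrable_const _).add j5
  have hmeas : Measurable (fun p : ℝ × ℝ => φ p.1 * φ (ι * p.1 + σ * p.2)) := by
    fun_prop
  have hf : Integrable (fun p : ℝ × ℝ => φ p.1 * φ (ι * p.1 + σ * p.2)) P :=
    hG.mono' hmeas.aestronglyMeasurable (Filter.Eventually.of_forall hfG)
  have hle : ∫ p, φ p.1 * φ (ι * p.1 + σ * p.2) ∂P ≤ ∫ p, G p ∂P :=
    integral_mono hf hG (fun p => (le_abs_self _).trans (hfG p))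
  have hGv : ∫ p, G p ∂P = ε ^ 2 + (ε * L * Real.exp (1 / 2) + (ε * L * Real.exp (1 / 2) +
      L ^ 2 * (2 / μ ^ 2 * Real.exp ((1 - β ^ 2) / (1 + ι))))) := by
    simp only [G]
    rw [integral_add (integrable_const _) j5, integral_add j1 j4,
      integral_add j2 j3, integral_const_mul, integral_const_mul, integral_const_mul, v1, v2, v3]
    have w2 : ι ^ 2 + σ ^ 2 = 1 := by rw [hσ2]; ring
    have w3 : K * Real.exp ((μ ^ 2 + (l * σ / 2) ^ 2) / 2) =
        2 / μ ^ 2 * Real.exp ((1 - β ^ 2) / (1 + ι)) := by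
      rw [hK, mul_assoc, ← Real.exp_add]
      congr 2
      have : (l * σ / 2) ^ 2 = l ^ 2 * (1 - ι ^ 2) / 4 := by rw [← hσ2]; ring
      rw [this, hl, hμ]
      field_simp
      ring
    rw [w2, mul_assoc (L ^ 2), w3]
    simp
  -- the tails
  set κ := Real.sqrt ((1 - ι) / (1 + ι)) with hκ
  have hκ0 : 0 ≤ κ := Real.sqrt_nonneg _
  have hκ2 : κ ^ 2 = (1 - ι) / (1 + ι) :=
    Real.sq_sqrt (div_nonneg (by linarith) (by linarith))
  have hκ1 : κ ≤ 1 := by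
    rw [hκ]
    apply Real.sqrt_le_one.mpr
    rw [div_le_one (by positivity)]; linarith
  have t1 := gaussTail_lower β hβ.le
  have t2 := gaussTail_lower (β * κ) (by positivity)
  have t3 := mul_le_mul t1 t2 (by positivity) (le_trans (by positivity) t1)
  set T := gaussTail β * gaussTail (β * κ) with hT
  have key : 2 / μ ^ 2 * Real.exp ((1 - β ^ 2) / (1 + ι)) ≤ 4 * Real.pi * Real.exp 4 * T := by
    have k1 : Real.exp ((1 - β ^ 2) / (1 + ι)) ≤ Real.exp 1 * Real.exp (-(β ^ 2) / (1 + ι)) := by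
      rw [← Real.exp_add]
      apply Real.exp_le_exp.mpr
      have : 1 / (1 + ι) ≤ 1 := by rw [div_le_one (by positivity)]; linarith
      rw [sub_div, neg_div]; linarith
    have k2 : Real.exp (-(β ^ 2) / 2) * Real.exp (-((β * κ) ^ 2) / 2) =
        Real.exp (-(β ^ 2) / (1 + ι)) := by
      rw [← Real.exp_add, mul_pow, hκ2]
      congr 1
      field_simp
      ring
    have k3 : (1 + β) * (1 + β * κ) ≤ μ ^ 2 := by
      rw [hμ, sq]
      gcongr
      nlinarith
    have k4 : Real.exp (-(3 / 2)) * Real.exp (-(3 / 2)) = Real.exp (-3) := by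
      rw [← Real.exp_add]; norm_num
    have k5 : Real.sqrt (2 * Real.pi) * Real.sqrt (2 * Real.pi) = 2 * Real.pi :=
      Real.mul_self_sqrt (by positivity)
    have k6 : Real.exp (-3) / (2 * Real.pi) * (Real.exp (-(β ^ 2) / (1 + ι)) / μ ^ 2) ≤ T := by
      refine le_trans ?_ t3
      calc _ ≤ Real.exp (-3) / (2 * Real.pi) *
            (Real.exp (-(β ^ 2) / (1 + ι)) / ((1 + β) * (1 + β * κ))) := by gcongr
        _ = _ := by
          rw [← k2, ← k4]
          generalize Real.sqrt (2 * Real.pi) = q at k5 ⊢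
          rw [← k5, mul_div_mul_comm, mul_div_mul_comm]
          ring
    have k7 : Real.exp 4 * Real.exp (-3) = Real.exp 1 := by
      rw [← Real.exp_add]; norm_num
    calc _ ≤ 2 / μ ^ 2 * (Real.exp 1 * Real.exp (-(β ^ 2) / (1 + ι))) := by gcongr
      _ = 4 * Real.pi * Real.exp 4 *
          (Real.exp (-3) / (2 * Real.pi) * (Real.exp (-(β ^ 2) / (1 + ι)) / μ ^ 2)) := by
        rw [← k7]
        field_simp
        ring
      _ ≤ _ := by gcongr
  have hT0 : 0 ≤ T := le_trans (by positivity) t3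
  have hE : Real.exp (1 / 2) ≤ 3 := by
    have h1 : Real.exp (1 / 2) ≤ Real.exp 1 := Real.exp_le_exp.mpr (by norm_num)
    have h2 := Real.exp_one_lt_d9
    linarith
  have hC : 0 < Real.pi * Real.exp 4 := by positivity
  rw [mul_assoc _ (gaussTail β), ← hT]
  refine hle.trans ?_
  rw [hGv]
  have f1 := mul_le_mul_of_nonneg_left key (sq_nonneg L)
  have f2 := mul_le_mul_of_nonneg_left hE (show 0 ≤ ε * L by positivity)
  have f3 : ε ^ 2 ≤ L * ε := by nlinarith
  have f4 : 0 ≤ Real.pi * Real.exp 4 * (L * ε) := by positivity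
  have f5 : 0 ≤ Real.pi * Real.exp 4 * T := by positivity
  have f6 : 0 ≤ L ^ 2 * T := by positivity
  nlinarith
end

section
/- Upper bound for the first activation moment. Let b̄ < 0, L ≥ 0, ε ≥ 0, and let φ : ℝ → ℝ be a measurable function satisfying |φ(x)| ≤ ε + L·(x + b̄)·1{x > −b̄} for all x ∈ ℝ. Then for a standard Gaussian x ∼ N(0,1), E[ x·φ(x) ] ≤ L·Φ(−b̄) + ε·√(2/π). -/
open MeasureTheory ProbabilityTheory

lemma fam_tendsto (s : ℝ) : Filter.Tendsto (fun x : ℝ => x ^ s * Real.exp (-(1/2) * x ^ 2))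
    Filter.atTop (nhds 0) := by
  refine (rpow_mul_exp_neg_mul_sq_isLittleO_exp_neg (b := 1/2) (by norm_num) s).trans_tendsto ?_
  refine Real.tendsto_exp_atBot.comp ?_
  exact Filter.tendsto_id.const_mul_atTop_of_neg (by norm_num)

lemma fam_hasDeriv (x : ℝ) : HasDerivAt (fun x : ℝ => Real.exp (-(1/2) * x ^ 2))
    (-(x * Real.exp (-(1/2) * x ^ 2))) x := by
  have h : HasDerivAt (fun x : ℝ => -(1/2) * x ^ 2) (-x) x := by
    refine ((hasDerivAt_pow 2 x).const_mul (-(1/2) : ℝ)).congr_deriv ?_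
    norm_num
    ring
  convert! h.exp using 1
  ring

lemma fam_int0 : Integrable (fun x : ℝ => Real.exp (-(1/2) * x ^ 2)) :=
  integrable_exp_neg_mul_sq (by norm_num)

lemma fam_int1 : Integrable (fun x : ℝ => x * Real.exp (-(1/2) * x ^ 2)) :=
  integrable_mul_exp_neg_mul_sq (by norm_num)

lemma fam_int2 : Integrable (fun x : ℝ => x ^ 2 * Real.exp (-(1/2) * x ^ 2)) := by
  simpa using integrable_rpow_mul_exp_neg_mul_sq (b := 1/2) (by norm_num) (s := 2) (by norm_num)

lemma fam_intb (b : ℝ) : Integrable (fun x : ℝ => x * (x + b) * Real.exp (-(1/2) * x ^ 2)) := by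
  convert! fam_int2.add (fam_int1.const_mul b) using 1
  ext x
  simp only [Pi.add_apply]
  ring

lemma fam_tail (b : ℝ) : ∫ x in Set.Ioi (-b), x * (x + b) * Real.exp (-(1/2) * x ^ 2)
    = ∫ x in Set.Ioi (-b), Real.exp (-(1/2) * x ^ 2) := by
  have h := integral_Ioi_of_hasDerivAt_of_tendsto' (a := -b) (m := 0)
    (f := fun x : ℝ => (x + b) * Real.exp (-(1/2) * x ^ 2))
    (f' := fun x : ℝ => Real.exp (-(1/2) * x ^ 2) - x * (x + b) * Real.exp (-(1/2) * x ^ 2))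
    (fun x _ => by
      refine (((hasDerivAt_id x).add_const b).mul (fam_hasDeriv x)).congr_deriv ?_
      simp only [id]
      ring)
    (fam_int0.sub (fam_intb b)).integrableOn
    (by
      have h1 := fam_tendsto 1
      have h0 := (fam_tendsto 0).const_mul b
      have := h1.add h0
      simp only [Real.rpow_one, Real.rpow_zero, one_mul, mul_zero, add_zero] at this
      refine this.congr fun x => ?_
      ring)
  rw [integral_sub fam_int0.integrableOn (fam_intb b).integrableOn] at h
  simp only [neg_add_cancel, zero_mul, sub_zero] at h
  linarith

lemma fam_abs : ∫ x : ℝ, |x| * Real.exp (-(1/2) * x ^ 2) = 2 := by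
  have h := integral_Ioi_of_hasDerivAt_of_tendsto' (a := 0) (m := 0)
    (f := fun x : ℝ => - Real.exp (-(1/2) * x ^ 2))
    (f' := fun x : ℝ => x * Real.exp (-(1/2) * x ^ 2))
    (fun x _ => by
      refine (fam_hasDeriv x).neg.congr_deriv ?_
      ring)
    fam_int1.integrableOn
    (by
      have h0 := (fam_tendsto 0).neg
      simpa using h0)
  have h2 := integral_comp_abs (f := fun x : ℝ => x * Real.exp (-(1/2) * x ^ 2))
  simp only [sq_abs] at h2
  rw [h2, h]
  norm_num

lemma fam_const : (Real.sqrt (2 * Real.pi))⁻¹ * 2 = Real.sqrt (2 / Real.pi) := by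
  have hpi := Real.pi_pos
  symm
  rw [Real.sqrt_eq_iff_mul_self_eq (by positivity) (by positivity)]
  have : Real.sqrt (2 * Real.pi) * Real.sqrt (2 * Real.pi) = 2 * Real.pi :=
    Real.mul_self_sqrt (by positivity)
  have h3 : (Real.sqrt (2 * Real.pi))⁻¹ * 2 * ((Real.sqrt (2 * Real.pi))⁻¹ * 2)
    = 4 * (Real.sqrt (2 * Real.pi) * Real.sqrt (2 * Real.pi))⁻¹ := by
    rw [mul_inv]; ring
  rw [h3, this]
  field_simp
  norm_num

/-- Upper bound for the first activation moment: if `b̄ < 0`, `L ≥ 0`, `ε ≥ 0` and `φ` is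
measurable with `|φ(x)| ≤ ε + L(x+b̄)1{x>-b̄}`, then for `x ∼ N(0,1)`,
`E[x·φ(x)] ≤ L·Φ(-b̄) + ε·√(2/π)`. -/
theorem first_activation_moment_upper (b L ε : ℝ) (hb : b < 0) (hL : 0 ≤ L) (hε : 0 ≤ ε)
    (φ : ℝ → ℝ) (hφm : Measurable φ)
    (hφ : ∀ x : ℝ, |φ x| ≤ ε + L * (x + b) * (if -b < x then (1 : ℝ) else 0)) :
    ∫ x, x * φ x ∂(gaussianReal 0 1) ≤ L * gaussTail (-b) + ε * Real.sqrt (2 / Real.pi) := by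
  have hpdf : ∀ x, gaussianPDFReal 0 1 x
      = (Real.sqrt (2 * Real.pi))⁻¹ * Real.exp (-(1/2) * x ^ 2) := by
    intro x
    simp only [gaussianPDFReal, NNReal.coe_one, mul_one, sub_zero]
    congr 2
    ring
  rw [integral_gaussianReal_eq_integral_smul one_ne_zero]
  simp only [hpdf, smul_eq_mul]
  set c := (Real.sqrt (2 * Real.pi))⁻¹ with hc
  have hc0 : 0 ≤ c := by positivity
  have hT : gaussTail (-b) = c * ∫ x in Set.Ioi (-b), Real.exp (-(1/2) * x ^ 2) := by
    rw [gaussTail, ← integral_const_mul]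
    congr 1
    ext x
    rw [div_eq_mul_inv, mul_comm, hc]
    congr 2
    ring
  let g1 : ℝ → ℝ := fun x => (c * ε) * (|x| * Real.exp (-(1/2) * x ^ 2))
  let g2 : ℝ → ℝ := fun x => (c * L) *
    (Set.Ioi (-b)).indicator (fun x => x * (x + b) * Real.exp (-(1/2) * x ^ 2)) x
  have i1 : Integrable g1 := by
    refine Integrable.const_mul ?_ _
    convert! fam_int1.norm using 1
    ext x
    rw [norm_mul, Real.norm_eq_abs, Real.norm_eq_abs, Real.abs_exp]
  have i2 : Integrable g2 :=
    ((fam_intb b).indicator measurableSet_Ioi).const_mul _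
  have hbound : ∀ x, ‖c * Real.exp (-(1/2) * x ^ 2) * (x * φ x)‖ ≤ g1 x + g2 x := by
    intro x
    have he := Real.exp_pos (-(1/2) * x ^ 2)
    rw [Real.norm_eq_abs, abs_mul, abs_mul x, abs_of_nonneg (by positivity)]
    calc _ ≤ c * Real.exp (-(1/2) * x ^ 2) *
          (|x| * (ε + L * (x + b) * (if -b < x then (1 : ℝ) else 0))) := by
          gcongr
          exact hφ x
      _ = g1 x + g2 x := by
          simp only [g1, g2, Set.indicator, Set.mem_Ioi]
          split_ifs with h
          · rw [abs_of_pos (by linarith : 0 < x)]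
            ring
          · ring
  have hint : Integrable (fun x => c * Real.exp (-(1/2) * x ^ 2) * (x * φ x)) := by
    refine (i1.add i2).mono' ?_ (ae_of_all _ hbound)
    exact Measurable.aestronglyMeasurable (by fun_prop)
  calc _ ≤ ∫ x, (g1 x + g2 x) :=
        integral_mono hint (i1.add i2) fun x => (le_abs_self _).trans (hbound x)
    _ = _ := by
        rw [integral_add i1 i2, integral_const_mul, integral_const_mul, fam_abs,
          integral_indicator measurableSet_Ioi, fam_tail, hT, ← fam_const]
        ring
end

section
/- Lower bound for the first activation moment. Let b ≤ b̄ < 0, let C₀ > 0 and ε ≥ 0, and let φ : ℝ → ℝ be a measurable function satisfying: φ(x) ≥ C₀·x·(x + b) for all x ≥ −b; φ(x) ≥ −ε for all x ∈ [−b̄, −b]; and |φ(x)| ≤ ε for all x ≤ −b̄. Then for a standard Gaussian x ∼ N(0,1), E[ x·φ(x) ] ≥ C₀·Φ(−b) − 2ε. -/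
open MeasureTheory ProbabilityTheory

lemma aux_tendsto_gauss : Filter.Tendsto (fun x : ℝ => Real.exp (-(x ^ 2) / 2)) Filter.atTop (nhds 0) := by
  apply Real.tendsto_exp_atBot.comp
  have h : Filter.Tendsto (fun x : ℝ => x ^ 2) Filter.atTop Filter.atTop :=
    Filter.tendsto_pow_atTop (by norm_num)
  have h2 := Filter.tendsto_neg_atTop_atBot.comp h
  exact h2.atBot_div_const (by norm_num)

lemma aux_tendsto_poly : Filter.Tendsto (fun x : ℝ => x ^ 2 * Real.exp (-(x ^ 2) / 2))
    Filter.atTop (nhds 0) := by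
  have h : Filter.Tendsto (fun x : ℝ => x ^ 2 / 2) Filter.atTop Filter.atTop :=
    (Filter.tendsto_pow_atTop (by norm_num)).atTop_div_const (by norm_num)
  have h2 := ((Real.tendsto_pow_mul_exp_neg_atTop_nhds_zero 1).comp h).const_mul 2
  simp only [mul_zero] at h2
  refine h2.congr fun x => ?_
  simp only [Function.comp, pow_one, neg_div]
  ring

lemma aux_tendsto_lin : Filter.Tendsto (fun x : ℝ => x * Real.exp (-(x ^ 2) / 2))
    Filter.atTop (nhds 0) := by
  refine squeeze_zero' ?_ ?_ aux_tendsto_poly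
  · filter_upwards [Filter.eventually_ge_atTop 0] with x hx
    positivity
  · filter_upwards [Filter.eventually_ge_atTop 1] with x hx
    have : x ≤ x ^ 2 := by nlinarith
    gcongr

lemma aux_deriv (x : ℝ) : HasDerivAt (fun x : ℝ => Real.exp (-(x ^ 2) / 2))
    (-x * Real.exp (-(x ^ 2) / 2)) x := by
  have h : HasDerivAt (fun x : ℝ => -(x ^ 2) / 2) (-x) x := by
    have := ((hasDerivAt_pow 2 x).neg).div_const 2
    refine this.congr_deriv ?_
    simp only [Nat.cast_ofNat]
    ring
  convert h.exp using 1
  ring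

lemma aux_G (a : ℝ) (ha : 0 < a) :
    IntegrableOn (fun x : ℝ => (x ^ 2 * (x - a) + a) * Real.exp (-(x ^ 2) / 2)) (Set.Ioi a) ∧
    ∫ x in Set.Ioi a, (x ^ 2 * (x - a) + a) * Real.exp (-(x ^ 2) / 2)
      = 2 * Real.exp (-(a ^ 2) / 2) := by
  have hd : ∀ x ∈ Set.Ici a, HasDerivAt (fun x : ℝ => -(x ^ 2 + 2 - a * x) * Real.exp (-(x ^ 2) / 2))
      ((x ^ 2 * (x - a) + a) * Real.exp (-(x ^ 2) / 2)) x := by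
    intro x _
    have hp : HasDerivAt (fun x : ℝ => -(x ^ 2 + 2 - a * x)) (-(2 * x - a)) x := by
      have := ((((hasDerivAt_pow 2 x).add_const 2).sub ((hasDerivAt_id x).const_mul a))).neg
      refine this.congr_deriv ?_
      simp
    refine (hp.mul (aux_deriv x)).congr_deriv ?_
    ring
  have hpos : ∀ x ∈ Set.Ioi a, 0 ≤ (x ^ 2 * (x - a) + a) * Real.exp (-(x ^ 2) / 2) := by
    intro x hx
    have : 0 ≤ x - a := by simp at hx; linarith
    positivity
  have ht : Filter.Tendsto (fun x : ℝ => -(x ^ 2 + 2 - a * x) * Real.exp (-(x ^ 2) / 2))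
      Filter.atTop (nhds 0) := by
    have := ((aux_tendsto_lin.const_mul a).sub (aux_tendsto_gauss.const_mul 2)).sub aux_tendsto_poly
    simp only [mul_zero, sub_zero] at this
    refine this.congr fun x => ?_
    ring
  refine ⟨integrableOn_Ioi_deriv_of_nonneg' hd hpos ht, ?_⟩
  rw [integral_Ioi_of_hasDerivAt_of_nonneg' hd hpos ht]
  ring

lemma aux_H (a : ℝ) (ha : 0 < a) :
    IntegrableOn (fun x : ℝ => (2 * x ^ 2 + 2 * x + 2) / (1 + x) ^ 2 * Real.exp (-(x ^ 2) / 2)) (Set.Ioi a) ∧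
    ∫ x in Set.Ioi a, (2 * x ^ 2 + 2 * x + 2) / (1 + x) ^ 2 * Real.exp (-(x ^ 2) / 2)
      = 2 / (1 + a) * Real.exp (-(a ^ 2) / 2) := by
  have hd : ∀ x ∈ Set.Ici a, HasDerivAt (fun x : ℝ => -2 * (1 + x)⁻¹ * Real.exp (-(x ^ 2) / 2))
      ((2 * x ^ 2 + 2 * x + 2) / (1 + x) ^ 2 * Real.exp (-(x ^ 2) / 2)) x := by
    intro x hx
    have hx0 : 1 + x ≠ 0 := by simp at hx; linarith
    have hp : HasDerivAt (fun x : ℝ => -2 * (1 + x)⁻¹) (-2 * (-1 / (1 + x) ^ 2)) x :=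
      (((hasDerivAt_id x).const_add 1).inv hx0).const_mul (-2)
    refine (hp.mul (aux_deriv x)).congr_deriv ?_
    field_simp
    ring
  have hpos : ∀ x ∈ Set.Ioi a, 0 ≤ (2 * x ^ 2 + 2 * x + 2) / (1 + x) ^ 2 * Real.exp (-(x ^ 2) / 2) := by
    intro x hx
    have : 0 ≤ x := by simp at hx; linarith
    positivity
  have ht : Filter.Tendsto (fun x : ℝ => -2 * (1 + x)⁻¹ * Real.exp (-(x ^ 2) / 2))
      Filter.atTop (nhds 0) := by
    have h1 : Filter.Tendsto (fun x : ℝ => (1 + x)⁻¹) Filter.atTop (nhds 0) :=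
      tendsto_inv_atTop_zero.comp (Filter.tendsto_atTop_add_const_left _ 1 Filter.tendsto_id)
    simpa using (h1.const_mul (-2)).mul aux_tendsto_gauss
  refine ⟨integrableOn_Ioi_deriv_of_nonneg' hd hpos ht, ?_⟩
  rw [integral_Ioi_of_hasDerivAt_of_nonneg' hd hpos ht]
  field_simp
  ring

lemma aux_key (a : ℝ) (ha : 0 < a) :
    ∫ x in Set.Ioi a, Real.exp (-(x ^ 2) / 2) ≤
    ∫ x in Set.Ioi a, (x ^ 2 * (x - a)) * Real.exp (-(x ^ 2) / 2) := by
  obtain ⟨hG, hG'⟩ := aux_G a ha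
  obtain ⟨hH, hH'⟩ := aux_H a ha
  have hg : IntegrableOn (fun x : ℝ => Real.exp (-(x ^ 2) / 2)) (Set.Ioi a) := by
    have := integrable_exp_neg_mul_sq (b := 1 / 2) (by norm_num)
    refine Integrable.integrableOn (this.congr (Filter.Eventually.of_forall fun x => ?_))
    simp only
    congr 1
    ring
  have e1 : ∫ x in Set.Ioi a, (x ^ 2 * (x - a)) * Real.exp (-(x ^ 2) / 2)
      = 2 * Real.exp (-(a ^ 2) / 2) - a * ∫ x in Set.Ioi a, Real.exp (-(x ^ 2) / 2) := by
    rw [← hG', ← integral_const_mul, ← integral_sub hG (hg.const_mul a)]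
    congr 1
    ext x
    ring
  have e2 : ∫ x in Set.Ioi a, Real.exp (-(x ^ 2) / 2) ≤ 2 / (1 + a) * Real.exp (-(a ^ 2) / 2) := by
    rw [← hH']
    refine setIntegral_mono_on hg hH measurableSet_Ioi fun x hx => ?_
    have hx0 : 0 < x := lt_trans ha hx
    refine le_mul_of_one_le_left (Real.exp_pos _).le ?_
    rw [le_div_iff₀ (by positivity)]
    nlinarith [sq_nonneg x]
  rw [e1]
  have e3 : (1 + a) * ∫ x in Set.Ioi a, Real.exp (-(x ^ 2) / 2) ≤ 2 * Real.exp (-(a ^ 2) / 2) := by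
    calc _ ≤ (1 + a) * (2 / (1 + a) * Real.exp (-(a ^ 2) / 2)) := by gcongr
      _ = _ := by field_simp
  linarith

lemma aux_moment : ∫ x : ℝ, x ^ 2 ∂(gaussianReal 0 1) = 1 := by
  have h := variance_id_gaussianReal (μ := 0) (v := 1)
  rw [variance_eq_integral (by fun_prop)] at h
  simpa using h

lemma aux_int (n : ℕ) : Integrable (fun x : ℝ => x ^ n) (gaussianReal 0 1) := by
  have h := (memLp_id_gaussianReal (μ := 0) (v := 1) n).integrable_norm_pow'
  refine h.mono (by fun_prop) (Filter.Eventually.of_forall fun x => ?_)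
  simp

theorem first_activation_moment_lower (b bbar C₀ ε : ℝ)
    (hbb : b ≤ bbar) (hbbar : bbar < 0) (hC₀ : 0 < C₀) (hε : 0 ≤ ε)
    (φ : ℝ → ℝ) (hφm : Measurable φ)
    (h1 : ∀ x : ℝ, -b ≤ x → C₀ * x * (x + b) ≤ φ x)
    (h2 : ∀ x : ℝ, -bbar ≤ x → x ≤ -b → -ε ≤ φ x)
    (h3 : ∀ x : ℝ, x ≤ -bbar → |φ x| ≤ ε)
    (hint : Integrable (fun x => x * φ x) (gaussianReal 0 1)) :
    C₀ * gaussTail (-b) - 2 * ε ≤ ∫ x, x * φ x ∂(gaussianReal 0 1) := by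
  have ha : 0 < -b := by linarith
  set f : ℝ → ℝ := (Set.Ioi (-b)).indicator (fun x => x ^ 2 * (x - -b)) with hf
  have hfi : Integrable f (gaussianReal 0 1) := by
    refine Integrable.indicator ?_ measurableSet_Ioi
    refine ((aux_int 3).add ((aux_int 2).const_mul b)).congr (Filter.Eventually.of_forall fun x => ?_)
    simp
    ring
  have hq : Integrable (fun x : ℝ => ε * ((1 + x ^ 2) / 2)) (gaussianReal 0 1) :=
    ((((integrable_const 1).add (aux_int 2))).div_const 2).const_mul ε
  have hfint : gaussTail (-b) ≤ ∫ x, f x ∂(gaussianReal 0 1) := by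
    have hs : 0 < Real.sqrt (2 * Real.pi) := by positivity
    rw [integral_gaussianReal_eq_integral_smul (by norm_num)]
    have : ∀ x, gaussianPDFReal 0 1 x • f x = (Set.Ioi (-b)).indicator
        (fun x => (x ^ 2 * (x - -b)) * Real.exp (-(x ^ 2) / 2) / Real.sqrt (2 * Real.pi)) x := by
      intro x
      by_cases hx : x ∈ Set.Ioi (-b)
      · simp only [hf, Set.indicator_of_mem hx, gaussianPDFReal, smul_eq_mul]
        simp
        field_simp
      · simp only [hf, Set.indicator_of_notMem hx, smul_zero]
    simp_rw [this]
    rw [integral_indicator measurableSet_Ioi, gaussTail, integral_div, integral_div]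
    have := aux_key (-b) ha
    gcongr
  have hqint : ∫ x : ℝ, ε * ((1 + x ^ 2) / 2) ∂(gaussianReal 0 1) = ε := by
    rw [integral_const_mul, integral_div, integral_add (integrable_const 1) (aux_int 2), aux_moment]
    simp
  have hmain : ∫ x, (C₀ * f x - ε * ((1 + x ^ 2) / 2)) ∂(gaussianReal 0 1)
      ≤ ∫ x, x * φ x ∂(gaussianReal 0 1) := by
    refine integral_mono ((hfi.const_mul C₀).sub hq) hint fun x => ?_
    simp only
    have hx1 : x ≤ (1 + x ^ 2) / 2 := by nlinarith [sq_nonneg (x - 1)]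
    have hx2 : -x ≤ (1 + x ^ 2) / 2 := by nlinarith [sq_nonneg (x + 1)]
    by_cases hx : x ∈ Set.Ioi (-b)
    · rw [hf, Set.indicator_of_mem hx]
      have hx' : -b < x := hx
      have := mul_le_mul_of_nonneg_left (h1 x hx'.le) (by linarith : 0 ≤ x)
      have h0 : 0 ≤ ε * ((1 + x ^ 2) / 2) := by positivity
      nlinarith
    · rw [hf, Set.indicator_of_notMem hx]
      have hx' : x ≤ -b := by simpa using hx
      rcases le_total (-bbar) x with hc | hc
      · have := mul_le_mul_of_nonneg_left (h2 x hc hx') (by linarith : 0 ≤ x)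
        have := mul_le_mul_of_nonneg_left hx1 hε
        nlinarith
      · have h4 : |x * φ x| ≤ (1 + x ^ 2) / 2 * ε := by
          rw [abs_mul]
          exact mul_le_mul (abs_le.2 ⟨by linarith, hx1⟩) (h3 x hc) (abs_nonneg _) (by positivity)
        have := (abs_le.1 h4).1
        linarith
  rw [integral_sub (hfi.const_mul C₀) hq, integral_const_mul, hqint] at hmain
  have := mul_le_mul_of_nonneg_left hfint hC₀.le
  linarith
end

section
/- Power inequality for the Gaussian tail. For every τ ∈ (0,1) and every real b ≥ 1, Φ(τ b) ≤ (2/τ) · Φ(b)^{τ²}, where Φ is the standard Gaussian tail function. -/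
open MeasureTheory

lemma gauss_integrable : Integrable (fun u : ℝ => Real.exp (-(u ^ 2) / 2)) := by
  have h := integrable_exp_neg_mul_sq (b := 1/2) (by norm_num)
  refine h.congr (Filter.Eventually.of_forall fun u => ?_)
  simp only
  congr 1; ring

lemma gauss_hasDeriv (x : ℝ) :
    HasDerivAt (fun u : ℝ => Real.exp (-(u ^ 2) / 2)) (-x * Real.exp (-(x ^ 2) / 2)) x := by
  have h : HasDerivAt (fun u : ℝ => -(u ^ 2) / 2) (-x) x := by
    have := ((hasDerivAt_pow 2 x).neg).div_const 2
    refine this.congr_deriv ?_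
    simp
    ring
  convert h.exp using 1
  ring

lemma gauss_tendsto :
    Filter.Tendsto (fun u : ℝ => Real.exp (-(u ^ 2) / 2)) Filter.atTop (nhds 0) := by
  apply Real.tendsto_exp_atBot.comp
  have h : Filter.Tendsto (fun u : ℝ => u ^ 2 / 2) Filter.atTop Filter.atTop :=
    (Filter.tendsto_pow_atTop (by norm_num)).atTop_div_const (by norm_num)
  refine (Filter.tendsto_neg_atTop_atBot.comp h).congr fun u => ?_
  simp only [Function.comp]; ring

lemma gauss_upper (x : ℝ) (hx : 0 < x) :
    ∫ u in Set.Ioi x, Real.exp (-(u ^ 2) / 2) ≤ Real.exp (-(x ^ 2) / 2) / x := by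
  have hd : ∀ u ∈ Set.Ici x, HasDerivAt (fun u : ℝ => -(Real.exp (-(u ^ 2) / 2) / x))
      (u / x * Real.exp (-(u ^ 2) / 2)) u := by
    intro u _
    refine ((gauss_hasDeriv u).div_const x).neg.congr_deriv ?_
    ring
  have ht : Filter.Tendsto (fun u : ℝ => -(Real.exp (-(u ^ 2) / 2) / x)) Filter.atTop (nhds 0) := by
    simpa using (gauss_tendsto.div_const x).neg
  have hnn : ∀ u ∈ Set.Ioi x, 0 ≤ u / x * Real.exp (-(u ^ 2) / 2) := by
    intro u hu
    have : 0 < u := hx.trans hu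
    positivity
  have hi := integrableOn_Ioi_deriv_of_nonneg' hd hnn ht
  have he := integral_Ioi_of_hasDerivAt_of_tendsto' hd hi ht
  calc _ ≤ ∫ u in Set.Ioi x, u / x * Real.exp (-(u ^ 2) / 2) := by
        refine setIntegral_mono_on gauss_integrable.integrableOn hi measurableSet_Ioi ?_
        intro u hu
        have h1 : 1 ≤ u / x := by rw [one_le_div hx]; exact le_of_lt hu
        exact le_mul_of_one_le_left (Real.exp_pos _).le h1
    _ = _ := by rw [he]; ring

lemma gauss_lower (x : ℝ) (hx : 1 ≤ x) :
    x / (x ^ 2 + 1) * Real.exp (-(x ^ 2) / 2) ≤ ∫ u in Set.Ioi x, Real.exp (-(u ^ 2) / 2) := by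
  have hd : ∀ u ∈ Set.Ici x,
      HasDerivAt (fun u : ℝ => -(u / (u ^ 2 + 1) * Real.exp (-(u ^ 2) / 2)))
      ((1 - 2 / (u ^ 2 + 1) ^ 2) * Real.exp (-(u ^ 2) / 2)) u := by
    intro u _
    have hne : u ^ 2 + 1 ≠ 0 := by positivity
    have h1 := (hasDerivAt_id' u).div ((hasDerivAt_pow 2 u).add_const 1) hne
    refine (h1.mul (gauss_hasDeriv u)).neg.congr_deriv ?_
    simp
    field_simp
    ring
  have ht : Filter.Tendsto (fun u : ℝ => -(u / (u ^ 2 + 1) * Real.exp (-(u ^ 2) / 2)))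
      Filter.atTop (nhds 0) := by
    rw [← neg_zero]
    refine Filter.Tendsto.neg ?_
    refine tendsto_of_tendsto_of_tendsto_of_le_of_le' tendsto_const_nhds gauss_tendsto ?_ ?_
    · filter_upwards [Filter.eventually_ge_atTop 0] with u hu
      positivity
    · filter_upwards [Filter.eventually_ge_atTop 0] with u hu
      refine mul_le_of_le_one_left (Real.exp_pos _).le ?_
      rw [div_le_one (by positivity)]
      nlinarith [sq_nonneg (u - 1)]
  have hnn : ∀ u ∈ Set.Ioi x, 0 ≤ (1 - 2 / (u ^ 2 + 1) ^ 2) * Real.exp (-(u ^ 2) / 2) := by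
    intro u hu
    have hu1 : 1 ≤ u := hx.trans (le_of_lt hu)
    refine mul_nonneg ?_ (Real.exp_pos _).le
    rw [sub_nonneg, div_le_one (by positivity)]
    nlinarith [sq_nonneg u, sq_nonneg (u^2)]
  have hi := integrableOn_Ioi_deriv_of_nonneg' hd hnn ht
  have he := integral_Ioi_of_hasDerivAt_of_tendsto' hd hi ht
  calc _ = ∫ u in Set.Ioi x, (1 - 2 / (u ^ 2 + 1) ^ 2) * Real.exp (-(u ^ 2) / 2) := by
        rw [he]; ring
    _ ≤ _ := by
        refine setIntegral_mono_on hi gauss_integrable.integrableOn measurableSet_Ioi ?_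
        intro u hu
        refine mul_le_of_le_one_left (Real.exp_pos _).le ?_
        have : 0 ≤ 2 / (u ^ 2 + 1) ^ 2 := by positivity
        linarith

/-- Power inequality for the Gaussian tail: for every `τ ∈ (0,1)` and `b ≥ 1`,
`Φ(τb) ≤ (2/τ)·Φ(b)^(τ²)`. -/
theorem gaussTail_power_inequality (τ b : ℝ) (hτ0 : 0 < τ) (hτ1 : τ < 1) (hb : 1 ≤ b) :
    gaussTail (τ * b) ≤ (2 / τ) * gaussTail b ^ (τ ^ 2) := by
  have hb0 : 0 < b := by linarith
  have hu := gauss_upper (τ * b) (by positivity)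
  have hl := gauss_lower b hb
  have ht2 : τ ^ 2 ≤ 1 := by nlinarith
  unfold gaussTail
  rw [integral_div, integral_div]
  set c := Real.sqrt (2 * Real.pi) with hc
  have hc1 : 1 ≤ c := by
    rw [hc, Real.one_le_sqrt]
    linarith [Real.pi_gt_three]
  have hc0 : 0 < c := by linarith
  set E := Real.exp (-(b ^ 2) / 2) with hE
  have hE0 : 0 < E := Real.exp_pos _
  have hEt : Real.exp (-((τ * b) ^ 2) / 2) = E ^ (τ ^ 2) := by
    rw [hE, ← Real.exp_mul]; congr 1; ring
  rw [hEt] at hu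
  have h1 : 1 / (2 * b) * E / c ≤ (∫ u in Set.Ioi b, Real.exp (-(u ^ 2) / 2)) / c := by
    refine div_le_div_of_nonneg_right (le_trans ?_ hl) hc0.le
    refine mul_le_mul_of_nonneg_right ?_ hE0.le
    rw [div_le_div_iff₀ (by positivity) (by positivity)]
    nlinarith
  have h2 := Real.rpow_le_rpow (by positivity) h1 (sq_nonneg τ)
  have h3 : 1 / (2 * b) * E ^ (τ ^ 2) / c ≤ (1 / (2 * b) * E / c) ^ (τ ^ 2) := by
    rw [Real.div_rpow (by positivity) hc0.le, Real.mul_rpow (by positivity) hE0.le]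
    have ha : 1 / (2 * b) ≤ (1 / (2 * b)) ^ (τ ^ 2) :=
      Real.self_le_rpow_of_le_one (by positivity)
        (by rw [div_le_one (by positivity)]; linarith) ht2
    have hcc : c ^ (τ ^ 2) ≤ c := Real.rpow_le_self_of_one_le hc1 ht2
    gcongr
  calc _ ≤ E ^ (τ ^ 2) / (τ * b) / c := by gcongr
    _ = 2 / τ * (1 / (2 * b) * E ^ (τ ^ 2) / c) := by field_simp
    _ ≤ _ := by
      refine mul_le_mul_of_nonneg_left (h3.trans h2) (by positivity)
end

section
/- Deterministic error propagation through a sparse matrix and a Lipschitz activation. Let F be an N×m real matrix whose rows f_1,…,f_N satisfy ‖f_l‖₂ ≤ 1 and ‖f_l‖₀ ≤ s, and suppose every column of F has at most k nonzero entries. Let φ : ℝ → ℝ be L-Lipschitz, applied entrywise to vectors, let c ∈ ℝ^N, and let y, y′ ∈ ℝ^m. Define Δφ = φ(F y + c) − φ(F y′ + c) ∈ ℝ^N and ΔF = F^⊤ Δφ ∈ ℝ^m. Then: (1) ‖ΔF‖₁ ≤ √s · N · L · ‖y − y′‖₂; (2) ‖ΔF‖₂ ≤ k · L · ‖y − y′‖₂;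 (3) ‖Δφ‖₂ ≤ √k · L · ‖y − y′‖₂. -/
/-- Cauchy-Schwarz localized to the support of the first factor. -/
lemma sparse_cs {n : ℕ} (a b : Fin n → ℝ) :
    (∑ i, a i * b i) ^ 2 ≤ (∑ i, a i ^ 2) * ∑ i, (if a i = 0 then 0 else 1) * b i ^ 2 := by
  have h := Finset.sum_mul_sq_le_sq_mul_sq Finset.univ a
    (fun i => (if a i = 0 then 0 else 1) * b i)
  have e1 : ∑ i, a i * ((if a i = 0 then 0 else 1) * b i) = ∑ i, a i * b i := by
    refine Finset.sum_congr rfl fun i _ => ?_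
    split_ifs with h0 <;> simp [h0]
  have e2 : ∑ i, ((if a i = 0 then 0 else 1) * b i) ^ 2
      = ∑ i, (if a i = 0 then 0 else 1) * b i ^ 2 := by
    refine Finset.sum_congr rfl fun i _ => ?_
    split_ifs with h0 <;> simp
  rw [e1, e2] at h
  exact h

lemma sparse_count {n : ℕ} (a : Fin n → ℝ) :
    ∑ i, (if a i = 0 then (0 : ℝ) else 1) = ((Function.support a).ncard : ℝ) := by
  have : Function.support a = ((Finset.univ.filter fun i => a i ≠ 0 : Finset (Fin n)) : Set (Fin n)) := by
    ext i; simp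
  rw [this, Set.ncard_coe_finset, Finset.card_filter]
  push_cast
  refine Finset.sum_congr rfl fun i _ => ?_
  split_ifs <;> simp_all

/-- Deterministic error propagation through a sparse matrix and a Lipschitz activation.
`F` is an `N × m` matrix with rows of ℓ2-norm at most 1 and at most `s` nonzero entries,
and with at most `k` nonzero entries per column; `φ` is `L`-Lipschitz.  With
`Δφ_l = φ((Fy)_l + c_l) - φ((Fy')_l + c_l)` and `ΔF = Fᵀ Δφ`:
(1) `‖ΔF‖₁ ≤ √s·N·L·‖y-y'‖₂`; (2) `‖ΔF‖₂ ≤ k·L·‖y-y'‖₂`; (3) `‖Δφ‖₂ ≤ √k·L·‖y-y'‖₂`. -/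
theorem sparse_lipschitz_error_propagation (N m s k : ℕ) (F : Fin N → Fin m → ℝ)
    (L : ℝ) (hL : 0 ≤ L)
    (hrow2 : ∀ l, Real.sqrt (∑ i, F l i ^ 2) ≤ 1)
    (hrow0 : ∀ l, (Function.support (F l)).ncard ≤ s)
    (hcol : ∀ i, (Function.support fun l => F l i).ncard ≤ k)
    (φ : ℝ → ℝ) (hφ : ∀ a b : ℝ, |φ a - φ b| ≤ L * |a - b|)
    (c : Fin N → ℝ) (y y' : Fin m → ℝ) :
    (∑ j, |∑ l, F l j * (φ ((∑ i, F l i * y i) + c l) - φ ((∑ i, F l i * y' i) + c l))| ≤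
        Real.sqrt s * N * L * Real.sqrt (∑ i, (y i - y' i) ^ 2)) ∧
    (Real.sqrt (∑ j,
          (∑ l, F l j * (φ ((∑ i, F l i * y i) + c l) - φ ((∑ i, F l i * y' i) + c l))) ^ 2) ≤
        k * L * Real.sqrt (∑ i, (y i - y' i) ^ 2)) ∧
    (Real.sqrt (∑ l, (φ ((∑ i, F l i * y i) + c l) - φ ((∑ i, F l i * y' i) + c l)) ^ 2) ≤
        Real.sqrt k * L * Real.sqrt (∑ i, (y i - y' i) ^ 2)) := by
  have hrow : ∀ l, ∑ i, F l i ^ 2 ≤ 1 := fun l => by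
    have := hrow2 l
    rwa [Real.sqrt_le_left zero_le_one, one_pow] at this
  set D : Fin N → ℝ := fun l => φ ((∑ i, F l i * y i) + c l) - φ ((∑ i, F l i * y' i) + c l)
    with hD
  set S : ℝ := ∑ i, (y i - y' i) ^ 2 with hS
  have hS0 : 0 ≤ S := Finset.sum_nonneg fun i _ => sq_nonneg _
  have hDabs : ∀ l, |D l| ≤ L * |∑ i, F l i * (y i - y' i)| := fun l => by
    refine (hφ _ _).trans (le_of_eq ?_)
    congr 2
    simp only [mul_sub, Finset.sum_sub_distrib]
    ring
  have hDsq : ∀ l, D l ^ 2 ≤ L ^ 2 * (∑ i, F l i * (y i - y' i)) ^ 2 := fun l => by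
    have := pow_le_pow_left₀ (abs_nonneg _) (hDabs l) 2
    rwa [mul_pow, sq_abs, sq_abs] at this
  have hloc : ∀ l, (∑ i, F l i * (y i - y' i)) ^ 2 ≤
      ∑ i, (if F l i = 0 then 0 else 1) * (y i - y' i) ^ 2 := fun l => by
    refine (sparse_cs _ _).trans (mul_le_of_le_one_left ?_ (hrow l))
    refine Finset.sum_nonneg fun i _ => ?_
    split_ifs <;> positivity
  have hglob : ∀ l, (∑ i, F l i * (y i - y' i)) ^ 2 ≤ S := fun l => by
    refine (hloc l).trans (Finset.sum_le_sum fun i _ => ?_)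
    split_ifs
    · simpa using sq_nonneg (y i - y' i)
    · simp
  have hcnt : ∀ i, ∑ l, (if F l i = 0 then (0 : ℝ) else 1) ≤ k := fun i => by
    rw [sparse_count (fun l => F l i)]
    exact_mod_cast hcol i
  have hDS : ∑ l, D l ^ 2 ≤ k * L ^ 2 * S := by
    calc ∑ l, D l ^ 2
        ≤ ∑ l, L ^ 2 * ∑ i, (if F l i = 0 then 0 else 1) * (y i - y' i) ^ 2 :=
          Finset.sum_le_sum fun l _ => (hDsq l).trans
            (mul_le_mul_of_nonneg_left (hloc l) (sq_nonneg L))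
      _ = L ^ 2 * ∑ i, (∑ l, (if F l i = 0 then (0 : ℝ) else 1)) * (y i - y' i) ^ 2 := by
          rw [← Finset.mul_sum, Finset.sum_comm]
          simp only [Finset.sum_mul]
      _ ≤ L ^ 2 * ∑ i, k * (y i - y' i) ^ 2 :=
          mul_le_mul_of_nonneg_left (Finset.sum_le_sum fun i _ =>
            mul_le_mul_of_nonneg_right (hcnt i) (sq_nonneg _)) (sq_nonneg L)
      _ = k * L ^ 2 * S := by rw [← Finset.mul_sum]; ring
  refine ⟨?_, ?_, ?_⟩
  · have hF1 : ∀ l, ∑ j, |F l j| ≤ Real.sqrt s := fun l => by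
      apply Real.le_sqrt_of_sq_le
      have h := sparse_cs (F l) (fun j => SignType.sign (F l j))
      have h1 : ∑ j, F l j * (SignType.sign (F l j) : ℝ) = ∑ j, |F l j| :=
        Finset.sum_congr rfl fun j _ => self_mul_sign _
      rw [h1] at h
      refine h.trans ((mul_le_of_le_one_left ?_ (hrow l)).trans ?_)
      · refine Finset.sum_nonneg fun i _ => ?_
        split_ifs <;> positivity
      · calc _ ≤ ∑ i, (if F l i = 0 then (0 : ℝ) else 1) := by
              refine Finset.sum_le_sum fun i _ => ?_
              rcases lt_trichotomy (F l i) 0 with h0 | h0 | h0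
              · simp [h0, h0.ne]
              · simp [h0]
              · simp [h0, h0.ne']
          _ ≤ s := by
              rw [sparse_count]
              exact_mod_cast hrow0 l
    have hDb : ∀ l, |D l| ≤ L * Real.sqrt S := fun l =>
      (hDabs l).trans (mul_le_mul_of_nonneg_left (Real.abs_le_sqrt (hglob l)) hL)
    calc ∑ j, |∑ l, F l j * D l|
        ≤ ∑ j, ∑ l, |F l j| * |D l| := Finset.sum_le_sum fun j _ =>
          (Finset.abs_sum_le_sum_abs _ _).trans (le_of_eq (by simp only [abs_mul]))
      _ = ∑ l, (∑ j, |F l j|) * |D l| := by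
          rw [Finset.sum_comm]
          simp only [Finset.sum_mul]
      _ ≤ ∑ l : Fin N, Real.sqrt s * (L * Real.sqrt S) := Finset.sum_le_sum fun l _ =>
          mul_le_mul (hF1 l) (hDb l) (abs_nonneg _) (Real.sqrt_nonneg _)
      _ = _ := by
          simp only [Finset.sum_const, Finset.card_univ, Fintype.card_fin, nsmul_eq_mul]
          ring
  · rw [Real.sqrt_le_left (by positivity), mul_pow, Real.sq_sqrt hS0]
    have hj : ∀ j, (∑ l, F l j * D l) ^ 2 ≤ k * ∑ l, F l j ^ 2 * D l ^ 2 := fun j => by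
      have h := Finset.sum_mul_sq_le_sq_mul_sq Finset.univ
        (fun l => if F l j = 0 then (0 : ℝ) else 1) (fun l => F l j * D l)
      have e1 : ∑ l, (if F l j = 0 then (0 : ℝ) else 1) * (F l j * D l)
          = ∑ l, F l j * D l := by
        refine Finset.sum_congr rfl fun l _ => ?_
        split_ifs with h0 <;> simp [h0]
      have e2 : ∑ l, (if F l j = 0 then (0 : ℝ) else 1) ^ 2
          = ∑ l, (if F l j = 0 then (0 : ℝ) else 1) := by
        refine Finset.sum_congr rfl fun l _ => ?_
        split_ifs <;> simp
      rw [e1, e2] at h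
      simp only [mul_pow] at h
      exact h.trans (mul_le_mul_of_nonneg_right (hcnt j)
        (Finset.sum_nonneg fun l _ => by positivity))
    calc ∑ j, (∑ l, F l j * D l) ^ 2
        ≤ ∑ j, k * ∑ l, F l j ^ 2 * D l ^ 2 := Finset.sum_le_sum fun j _ => hj j
      _ = k * ∑ l, (∑ j, F l j ^ 2) * D l ^ 2 := by
          rw [← Finset.mul_sum, Finset.sum_comm]
          simp only [Finset.sum_mul]
      _ ≤ k * ∑ l, D l ^ 2 := mul_le_mul_of_nonneg_left (Finset.sum_le_sum fun l _ =>
          mul_le_of_le_one_left (sq_nonneg _) (hrow l)) (Nat.cast_nonneg k)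
      _ ≤ k * (k * L ^ 2 * S) := mul_le_mul_of_nonneg_left hDS (Nat.cast_nonneg k)
      _ = _ := by ring
  · rw [Real.sqrt_le_left (by positivity), mul_pow, mul_pow, Real.sq_sqrt hS0,
      Real.sq_sqrt (Nat.cast_nonneg k)]
    exact hDS
end

section
/- Sparse Cauchy–Schwarz bound for row sums of inner products. Let G be an N×m real matrix whose rows g_1,…,g_N satisfy ‖g_l‖₂ ≤ 1, and suppose every column of G has at most k nonzero entries. Then for every subset S ⊆ {1,…,N} and every Δ ∈ ℝ^m, Σ_{l ∈ S} |g_l^⊤ Δ| ≤ √( k · |S| ) · ‖Δ‖₂. -/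
/-- Sparse Cauchy–Schwarz bound for row sums of inner products: if every row of the
`N × m` matrix `G` has ℓ2-norm at most 1 and every column has at most `k` nonzero entries,
then for every `S ⊆ [N]` and `Δ ∈ ℝ^m`, `Σ_{l∈S} |g_lᵀΔ| ≤ √(k·|S|)·‖Δ‖₂`. -/
theorem sparse_cauchy_schwarz_row_sums (N m k : ℕ) (G : Fin N → Fin m → ℝ)
    (hrow : ∀ l, Real.sqrt (∑ i, G l i ^ 2) ≤ 1)
    (hcol : ∀ i, (Function.support fun l => G l i).ncard ≤ k)
    (S : Finset (Fin N)) (Δ : Fin m → ℝ) :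
    ∑ l ∈ S, |∑ i, G l i * Δ i| ≤
      Real.sqrt ((k : ℝ) * S.card) * Real.sqrt (∑ i, Δ i ^ 2) := by
  classical
  have h1 : ∀ l, |∑ i, G l i * Δ i| ^ 2 ≤ ∑ i, (if G l i = 0 then 0 else Δ i ^ 2) := by
    intro l
    have hr : ∑ i, G l i ^ 2 ≤ 1 := Real.sqrt_le_one.mp (hrow l)
    have e : ∑ i, G l i * Δ i = ∑ i, G l i * (if G l i = 0 then 0 else Δ i) := by
      refine Finset.sum_congr rfl fun i _ => ?_
      split_ifs with h <;> simp [h]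
    have e2 : ∑ i, (if G l i = 0 then 0 else Δ i ^ 2)
        = ∑ i, (if G l i = 0 then 0 else Δ i) ^ 2 := by
      refine Finset.sum_congr rfl fun i _ => ?_
      split_ifs with h <;> simp
    rw [sq_abs, e, e2]
    refine (Finset.sum_mul_sq_le_sq_mul_sq _ _ _).trans ?_
    exact mul_le_of_le_one_left (Finset.sum_nonneg fun i _ => sq_nonneg _) hr
  have h2 : ∑ l ∈ S, |∑ i, G l i * Δ i| ^ 2 ≤ k * ∑ i, Δ i ^ 2 := by
    refine (Finset.sum_le_sum fun l _ => h1 l).trans ?_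
    rw [Finset.sum_comm, Finset.mul_sum]
    refine Finset.sum_le_sum fun i _ => ?_
    have hc : (S.filter fun l => ¬ G l i = 0).card ≤ k := by
      refine le_trans ?_ (hcol i)
      rw [← Set.ncard_coe_finset]
      refine Set.ncard_le_ncard ?_ (Set.toFinite _)
      intro l hl
      simp at hl
      simpa using hl.2
    have e : ∑ l ∈ S, (if G l i = 0 then 0 else Δ i ^ 2)
        = ((S.filter fun l => ¬ G l i = 0).card : ℝ) * Δ i ^ 2 := by
      rw [← nsmul_eq_mul, ← Finset.sum_const, Finset.sum_filter]
      refine Finset.sum_congr rfl fun l _ => ?_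
      split_ifs <;> simp_all
    rw [e]
    exact mul_le_mul_of_nonneg_right (by exact_mod_cast hc) (sq_nonneg _)
  rw [← Real.sqrt_mul (by positivity)]
  apply Real.le_sqrt_of_sq_le
  refine sq_sum_le_card_mul_sum_sq.trans ?_
  calc (S.card : ℝ) * ∑ l ∈ S, |∑ i, G l i * Δ i| ^ 2 ≤ S.card * (k * ∑ i, Δ i ^ 2) := by
        gcongr
    _ = _ := by ring
end
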